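/- arXiv:2101.04551 — 3 statements merged into one kernel-verified Lean document; each statement's English description precedes it below -/
import Mathlib

section
/- Let w be any one of the four Chebyshev weights. Then for all integers 0<m<n: sup_{|x|≤1} Σ_{k=1}^n |Φ_{n,k}^m(w;x)|·u(x)/u(x_k^n) ≤ C_w·sqrt(n_w/m)·(1 + 2π·m_w/n_w), where u, C_w, n_w, m_w are as specified in the context. (The left-hand side is the Lebesgue constant, i.e. the operator norm of V_n^m acting on C^0_u.) -/
open Real Set Finset Polynomial

noncomputable section

/-- The four kinds of Chebyshev weights. -/
inductive ChebKind | one | two | three | four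

/-- The Chebyshev weight function of each kind. -/
noncomputable def wFn : ChebKind → ℝ → ℝ
  | .one,   x => 1 / Real.sqrt (1 - x ^ 2)
  | .two,   x => Real.sqrt (1 - x ^ 2)
  | .three, x => Real.sqrt ((1 + x) / (1 - x))
  | .four,  x => Real.sqrt ((1 - x) / (1 + x))

/-- The orthonormal polynomials associated with each Chebyshev weight
(`p_j(w,·)`), expressed via Mathlib's Chebyshev polynomials of the first and
second kind.  On `[-1,1]` these coincide with the usual trigonometric forms. -/
noncomputable def pPoly : ChebKind → ℕ → Polynomial ℝ
  | .one, 0       => Polynomial.C (1 / Real.sqrt π)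
  | .one, (j + 1) => Polynomial.C (Real.sqrt (2 / π)) * Polynomial.Chebyshev.T ℝ ((j : ℤ) + 1)
  | .two, j       => Polynomial.C (Real.sqrt (2 / π)) * Polynomial.Chebyshev.U ℝ (j : ℤ)
  | .three, j     => Polynomial.C (1 / Real.sqrt π) *
      (Polynomial.Chebyshev.U ℝ (j : ℤ) - Polynomial.Chebyshev.U ℝ ((j : ℤ) - 1))
  | .four, j      => Polynomial.C (1 / Real.sqrt π) *
      (Polynomial.Chebyshev.U ℝ (j : ℤ) + Polynomial.Chebyshev.U ℝ ((j : ℤ) - 1))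

noncomputable def pEval (w : ChebKind) (j : ℕ) (x : ℝ) : ℝ := (pPoly w j).eval x

/-- Angular Chebyshev nodes `t_k^n`. -/
noncomputable def tNode : ChebKind → ℕ → ℕ → ℝ
  | .one,   n, k => (2 * (k : ℝ) - 1) * π / (2 * n)
  | .two,   n, k => (k : ℝ) * π / (n + 1)
  | .three, n, k => (2 * (k : ℝ) - 1) * π / (2 * n + 1)
  | .four,  n, k => 2 * (k : ℝ) * π / (2 * n + 1)

/-- Chebyshev nodes `x_k^n = cos t_k^n`, zeros of `p_n(w,·)`. -/
noncomputable def xNode (w : ChebKind) (n k : ℕ) : ℝ := Real.cos (tNode w n k)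

/-- Christoffel numbers `λ_k^n`. -/
noncomputable def lam : ChebKind → ℕ → ℕ → ℝ
  | .one,   n, _ => π / n
  | .two,   n, k => π / (n + 1) * Real.sin (tNode .two n k) ^ 2
  | .three, n, k => 4 * π / (2 * n + 1) * Real.cos (tNode .three n k / 2) ^ 2
  | .four,  n, k => 4 * π / (2 * n + 1) * Real.sin (tNode .four n k / 2) ^ 2

/-- de la Vallée Poussin filter coefficients `μ_{n,j}^m`. -/
noncomputable def mufilt (n m j : ℕ) : ℝ :=
  if j ≤ n - m then 1 else ((n : ℝ) + m - j) / (2 * m)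

/-- Fundamental VP polynomials `Φ_{n,k}^m(w;x)`. -/
noncomputable def Phi (w : ChebKind) (n m k : ℕ) (x : ℝ) : ℝ :=
  lam w n k * ∑ j ∈ Finset.range (n + m), mufilt n m j * pEval w j (xNode w n k) * pEval w j x

/-- The VP interpolation polynomial `V_n^m f`. -/
noncomputable def VP (w : ChebKind) (n m : ℕ) (f : ℝ → ℝ) (x : ℝ) : ℝ :=
  ∑ k ∈ Finset.Icc 1 n, f (xNode w n k) * Phi w n m k x

/-- Jacobi weight `u(x) = (1-x)^γ (1+x)^δ`. -/
noncomputable def jac (γ δ : ℝ) (x : ℝ) : ℝ := (1 - x) ^ γ * (1 + x) ^ δ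

/-- Weighted uniform norm `‖f·u‖ = max_{|x|≤1} |f(x) u(x)|`. -/
noncomputable def wnorm (γ δ : ℝ) (f : ℝ → ℝ) : ℝ :=
  sSup ((fun x => |f x * jac γ δ x|) '' Set.Icc (-1 : ℝ) 1)

/-- Error of best weighted polynomial approximation `E_n(f)_u`. -/
noncomputable def bestE (γ δ : ℝ) (n : ℕ) (f : ℝ → ℝ) : ℝ :=
  sInf ((fun P : Polynomial ℝ => wnorm γ δ (fun x => f x - P.eval x)) ''
    {P : Polynomial ℝ | P.natDegree ≤ n})

/-- Membership in the space `C^0_u`: `f` is continuous on compact subsets of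
`(-1,1)`, `f·u` extends continuously to `[-1,1]`, with value (= limit) `0` at
`±1` when the corresponding exponent is positive. -/
def MemC0 (γ δ : ℝ) (f : ℝ → ℝ) : Prop :=
  ContinuousOn f (Set.Ioo (-1 : ℝ) 1) ∧
  ContinuousOn (fun x => f x * jac γ δ x) (Set.Icc (-1 : ℝ) 1) ∧
  (0 < γ → f 1 * jac γ δ 1 = 0) ∧ (0 < δ → f (-1) * jac γ δ (-1) = 0)

/-- Conditions (hp-u) on the exponents of `u=(1-x)^γ(1+x)^δ` relative to `w`. -/
def hpu : ChebKind → ℝ → ℝ → Prop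
  | .one,   γ, δ => 0 ≤ γ ∧ γ ≤ 1 ∧ 0 ≤ δ ∧ δ ≤ 1
  | .two,   γ, δ => 0 < γ ∧ γ ≤ 3 / 2 ∧ 0 < δ ∧ δ ≤ 3 / 2 ∧ -1 ≤ γ - δ ∧ γ - δ ≤ 1
  | .three, γ, δ => 0 ≤ γ ∧ γ ≤ 1 ∧ 0 < δ ∧ δ ≤ 3 / 2 ∧ γ - δ ≤ 1 / 2
  | .four,  γ, δ => 0 < γ ∧ γ ≤ 3 / 2 ∧ 0 ≤ δ ∧ δ ≤ 1 ∧ -(1 / 2) ≤ γ - δ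

/-- `φ(x) = sqrt(1-x²)`. -/
noncomputable def phi (x : ℝ) : ℝ := Real.sqrt (1 - x ^ 2)

/-- The set of values `|f^{(r)}(x)| φ(x)^r u(x)`, `x ∈ (-1,1)`. -/
noncomputable def derSet (γ δ : ℝ) (r : ℕ) (f : ℝ → ℝ) : Set ℝ :=
  (fun x : ℝ => |iteratedDerivWithin r f (Set.Ioo (-1 : ℝ) 1) x| * phi x ^ r * jac γ δ x) ''
    Set.Ioo (-1 : ℝ) 1

/-- Membership in the Sobolev-type space `W_r(u)`. -/
def MemW (γ δ : ℝ) (r : ℕ) (f : ℝ → ℝ) : Prop :=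
  MemC0 γ δ f ∧ ContDiffOn ℝ r f (Set.Ioo (-1 : ℝ) 1) ∧ BddAbove (derSet γ δ r f)

/-- The norm of `W_r(u)`: `‖fu‖ + ‖f^{(r)} φ^r u‖`. -/
noncomputable def Wnorm (γ δ : ℝ) (r : ℕ) (f : ℝ → ℝ) : ℝ :=
  wnorm γ δ f + sSup (derSet γ δ r f)

/-- The set of values `(n+1)^r E_n(f)_u`, `n ≥ 1`. -/
noncomputable def zSet (γ δ r : ℝ) (f : ℝ → ℝ) : Set ℝ :=
  (fun n : ℕ => ((n : ℝ) + 1) ^ r * bestE γ δ n f) '' {n : ℕ | 1 ≤ n}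

/-- Membership in the Hölder–Zygmund space `Z_r(u)`. -/
def MemZ (γ δ r : ℝ) (f : ℝ → ℝ) : Prop := MemC0 γ δ f ∧ BddAbove (zSet γ δ r f)

/-- The norm of `Z_r(u)`: `‖fu‖ + sup_{n≥1} (n+1)^r E_n(f)_u`. -/
noncomputable def Znorm (γ δ r : ℝ) (f : ℝ → ℝ) : ℝ :=
  wnorm γ δ f + sSup (zSet γ δ r f)

/-- Exponents `(γ,δ)` of the weight `u = sqrt(w·φ)`. -/
def uExp : ChebKind → ℝ × ℝ
  | .one => (0, 0) | .two => (1 / 2, 1 / 2) | .three => (0, 1 / 2) | .four => (1 / 2, 0)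

/-- The constant `C_w`. -/
def Cw : ChebKind → ℝ | .one => 2 | _ => 1

/-- The quantity `n_w`. -/
noncomputable def nw : ChebKind → ℕ → ℝ
  | .one, n => n | .two, n => n + 1
  | .three, n => (2 * (n : ℝ) + 1) / 2 | .four, n => (2 * (n : ℝ) + 1) / 2

/-- The quantity `m_w`. -/
noncomputable def mw : ChebKind → ℕ → ℕ → ℝ
  | .one, n, m => (n : ℝ) + m | .two, n, m => (n : ℝ) + m
  | .three, n, m => 2 * ((n : ℝ) + m) - 1 | .four, n, m => 2 * ((n : ℝ) + m) - 1

/-- The polynomials `q_{n,j}^m(w,·)` (orthogonal VP basis). -/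
noncomputable def qq (w : ChebKind) (n m j : ℕ) (x : ℝ) : ℝ :=
  if j ≤ n - m then pEval w j x
  else ((m : ℝ) + n - j) / (2 * m) * pEval w j x
    - ((m : ℝ) + j - n) / (2 * m) * pEval w (2 * n - j) x

end

theorem cos_eq_one_sub_two_mul_sin_half_sq (s : ℝ) :
    Real.cos s = 1 - 2 * Real.sin (s / 2) ^ 2 := by
  have h := Real.cos_two_mul (s / 2)
  rw [mul_div_cancel₀ s two_ne_zero] at h
  linarith [Real.sin_sq_add_cos_sq (s / 2)]

/-- The squared modulus of `∑_{j<L} e^{ijs}`. -/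
noncomputable def fejerSum (L : ℕ) (s : ℝ) : ℝ :=
  (∑ j ∈ Finset.range L, Real.cos (j * s)) ^ 2 + (∑ j ∈ Finset.range L, Real.sin (j * s)) ^ 2

theorem fejerSum_nonneg (L : ℕ) (s : ℝ) : 0 ≤ fejerSum L s := by
  unfold fejerSum; positivity

theorem fejerSum_add_two_pi (L : ℕ) (s : ℝ) : fejerSum L (s + 2 * π) = fejerSum L s := by
  unfold fejerSum
  have hc (j : ℕ) : Real.cos (j * (s + 2 * π)) = Real.cos (j * s) := by
    rw [mul_add, Real.cos_add_nat_mul_two_pi]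
  have hs (j : ℕ) : Real.sin (j * (s + 2 * π)) = Real.sin (j * s) := by
    rw [mul_add, Real.sin_add_nat_mul_two_pi]
  simp only [hc, hs]

theorem fejerSum_eq_sum_cos (L : ℕ) (s : ℝ) :
    fejerSum L s =
      ∑ j ∈ Finset.range L, ∑ l ∈ Finset.range L, Real.cos (((j : ℝ) - l) * s) := by
  simp only [fejerSum, sq, Finset.sum_mul_sum, ← Finset.sum_add_distrib, sub_mul, Real.cos_sub]

theorem continuous_fejerSum (L : ℕ) : Continuous (fejerSum L) := by
  unfold fejerSum; fun_prop

theorem sin_sq_mul_fejerSum (L : ℕ) (s : ℝ) :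
    Real.sin (s / 2) ^ 2 * fejerSum L s = Real.sin (L * s / 2) ^ 2 := by
  have hc : 2 * Real.sin (s / 2) * ∑ j ∈ Finset.range L, Real.cos (j * s)
      = Real.sin (L * s - s / 2) + Real.sin (s / 2) := by
    induction L with
    | zero => simp
    | succ L ih =>
      rw [Finset.sum_range_succ, mul_add, ih]
      have e : ((L + 1 : ℕ) : ℝ) * s - s / 2 = L * s + s / 2 := by push_cast; ring
      rw [e, Real.sin_add, Real.sin_sub]; ring
  have hs : 2 * Real.sin (s / 2) * ∑ j ∈ Finset.range L, Real.sin (j * s)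
      = Real.cos (s / 2) - Real.cos (L * s - s / 2) := by
    clear hc
    induction L with
    | zero => simp
    | succ L ih =>
      rw [Finset.sum_range_succ, mul_add, ih]
      have e : ((L + 1 : ℕ) : ℝ) * s - s / 2 = L * s + s / 2 := by push_cast; ring
      rw [e, Real.cos_add, Real.cos_sub]; ring
  have h4 : 4 * (Real.sin (s / 2) ^ 2 * fejerSum L s)
      = (Real.sin (L * s - s / 2) + Real.sin (s / 2)) ^ 2
        + (Real.cos (s / 2) - Real.cos (L * s - s / 2)) ^ 2 := by
    rw [← hc, ← hs, fejerSum]; ring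
  have hd : Real.cos (L * s) = Real.cos (L * s - s / 2) * Real.cos (s / 2)
      - Real.sin (L * s - s / 2) * Real.sin (s / 2) := by
    rw [← Real.cos_add]; congr 1; ring
  have hL := cos_eq_one_sub_two_mul_sin_half_sq (L * s)
  nlinarith [Real.sin_sq_add_cos_sq (L * s - s / 2), Real.sin_sq_add_cos_sq (s / 2)]

theorem sum_cos_equispaced (M : ℕ) (hM : 0 < M) (q : ℤ) (hq : ¬ (M : ℤ) ∣ q) (θ : ℝ) :
    ∑ i ∈ Finset.range M, Real.cos (q * (θ - 2 * π * i / M)) = 0 := by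
  have hMr : (M : ℝ) ≠ 0 := by positivity
  have hMc : (M : ℂ) ≠ 0 := by exact_mod_cast hMr
  set ζ : ℂ := Complex.exp (-(q * (2 * π * Complex.I) / M)) with hζ
  have hζM : ζ ^ M = 1 := by
    rw [hζ, ← Complex.exp_nat_mul, Complex.exp_eq_one_iff]
    exact ⟨-q, by push_cast; field_simp⟩
  have hζ1 : ζ ≠ 1 := by
    rw [hζ, Ne, Complex.exp_eq_one_iff]
    rintro ⟨k, hk⟩
    apply hq
    have hpi : (2 * π * Complex.I : ℂ) ≠ 0 := Complex.two_pi_I_ne_zero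
    have h1 : (-(q : ℂ)) = k * M := by
      field_simp at hk
      linear_combination hk
    have h2 : -q = k * M := by exact_mod_cast h1
    exact ⟨-k, by linarith⟩
  have hsum : ∑ i ∈ Finset.range M, ζ ^ i = 0 := by
    rw [geom_sum_eq hζ1, hζM]; simp
  have hterm (i : ℕ) : Real.cos (q * (θ - 2 * π * i / M))
      = (Complex.exp (q * θ * Complex.I) * ζ ^ i).re := by
    rw [hζ, ← Complex.exp_nat_mul, ← Complex.exp_add, ← Complex.exp_ofReal_mul_I_re]
    congr 2; push_cast; ring
  simp only [hterm]
  rw [← Complex.re_sum, ← Finset.mul_sum, hsum]; simp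

theorem sum_fejerSum_equispaced (M L : ℕ) (hM : 0 < M) (hL : L ≤ M) (θ : ℝ) :
    ∑ i ∈ Finset.range M, fejerSum L (θ - 2 * π * i / M) = L * M := by
  simp only [fejerSum_eq_sum_cos]
  rw [Finset.sum_comm]
  have hj : ∀ j ∈ Finset.range L, (∑ i ∈ Finset.range M, ∑ l ∈ Finset.range L,
      Real.cos (((j : ℝ) - l) * (θ - 2 * π * i / M))) = M := by
    intro j hj
    rw [Finset.sum_comm, Finset.sum_eq_single_of_mem j hj]
    · simp
    · intro l hl hlj
      have := sum_cos_equispaced M hM ((j : ℤ) - l) ?_ θ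
      · push_cast at this; exact this
      · intro hdvd
        rw [Finset.mem_range] at hj hl
        have := Int.eq_zero_of_abs_lt_dvd hdvd (by rw [abs_lt]; omega)
        omega
  rw [Finset.sum_congr rfl hj]; simp

theorem sum_sqrt_fejerSum_equispaced_le (M L : ℕ) (hM : 0 < M) (hL : L ≤ M) (θ : ℝ) :
    ∑ i ∈ Finset.range M, √(fejerSum M (θ - 2 * π * i / M)) * √(fejerSum L (θ - 2 * π * i / M))
      ≤ M * √(L * M) := by
  refine (Real.sum_sqrt_mul_sqrt_le _ (fun i => fejerSum_nonneg _ _)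
    (fun i => fejerSum_nonneg _ _)).trans ?_
  rw [sum_fejerSum_equispaced M M hM le_rfl, sum_fejerSum_equispaced M L hM hL,
    Real.sqrt_mul_self (by positivity)]

theorem sum_symm_nodes_le (n M e : ℕ) (he : e ≤ 1) (hn : 2 * n < M + e) (hnM : n ≤ M)
    (f : ℝ → ℝ) (hf : ∀ s, 0 ≤ f s) (hper : ∀ s, f (s + 2 * π) = f s) (hM : 0 < M) (t : ℝ) :
    ∑ k ∈ Finset.Icc 1 n, (f (t - (2 * k - e) * π / M) + f (t + (2 * k - e) * π / M))
      ≤ ∑ i ∈ Finset.range M, f (t + e * π / M - 2 * π * (i + 1 : ℕ) / M) := by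
  have hMr : (M : ℝ) ≠ 0 := by positivity
  set g : ℕ → ℝ := fun i => f (t + e * π / M - 2 * π * i / M) with hg
  have h1 (k : ℕ) : f (t - (2 * k - e) * π / M) = g k := by
    simp only [hg]; congr 1; ring
  have h2 : ∀ k ∈ Finset.Icc 1 n, f (t + (2 * k - e) * π / M) = g (M + e - k) := by
    intro k hk
    rw [Finset.mem_Icc] at hk
    simp only [hg]
    refine Eq.trans ?_ (hper _)
    rw [Nat.cast_sub (by omega)]
    congr 1
    push_cast; field_simp; ring
  have h3 : ∑ k ∈ Finset.Icc 1 n, g (M + e - k)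
      = ∑ k ∈ (Finset.Icc 1 n).image (fun k => M + e - k), g k := by
    rw [Finset.sum_image]
    intro a ha b hb hab
    simp only [Finset.coe_Icc, Set.mem_Icc] at ha hb hab
    omega
  have h4 : ∑ i ∈ Finset.range M, g (i + 1) = ∑ i ∈ Finset.Icc 1 M, g i := by
    rw [Finset.range_eq_Ico, Finset.sum_Ico_add', zero_add, ← Finset.Ico_add_one_right_eq_Icc]
  rw [Finset.sum_add_distrib, Finset.sum_congr rfl h2]
  simp only [h1]
  rw [h3, ← Finset.sum_union]
  · rw [h4]
    refine Finset.sum_le_sum_of_subset_of_nonneg ?_ (fun i _ _ => hf _)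
    intro i hi
    simp only [Finset.mem_union, Finset.mem_image, Finset.mem_Icc] at hi ⊢
    rcases hi with hi | ⟨k, hk, rfl⟩ <;> omega
  · rw [Finset.disjoint_left]
    intro i hi hi'
    simp only [Finset.mem_image, Finset.mem_Icc] at hi hi'
    obtain ⟨k, hk, rfl⟩ := hi'
    omega

theorem dense_sin_half_ne_zero : Dense {s : ℝ | Real.sin (s / 2) ≠ 0} := by
  have hc : ({s : ℝ | Real.sin (s / 2) = 0}).Countable := by
    refine (Set.countable_range (fun k : ℤ => 2 * (k * π))).mono ?_
    intro s hs
    obtain ⟨k, hk⟩ := Real.sin_eq_zero_iff.1 hs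
    exact ⟨k, by simp only [hk]; ring⟩
  exact hc.dense_compl ℝ

theorem abs_kernel_eq (M m : ℕ) (hm : 0 < m) (K : ℝ → ℝ) (hKc : Continuous K)
    (hK : ∀ s, 2 * m * Real.sin (s / 2) ^ 2 * K s = Real.sin (M * s / 2) * Real.sin (m * s))
    (s : ℝ) :
    |K s| = √(fejerSum M s) * √(fejerSum (2 * m) s) / (2 * m) := by
  have hsq : ∀ s, (2 * m * K s) ^ 2 = fejerSum M s * fejerSum (2 * m) s := by
    have := Continuous.ext_on dense_sin_half_ne_zero
      (f := fun s => (2 * m * K s) ^ 2) (g := fun s => fejerSum M s * fejerSum (2 * m) s)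
      (by fun_prop) ((continuous_fejerSum M).mul (continuous_fejerSum _)) ?_
    · exact congrFun this
    · intro s hs
      have hs4 : Real.sin (s / 2) ^ 4 ≠ 0 := pow_ne_zero _ hs
      apply mul_left_cancel₀ hs4
      have e : Real.sin (m * s) = Real.sin ((2 * m : ℕ) * s / 2) := by
        congr 1; push_cast; ring
      calc Real.sin (s / 2) ^ 4 * (2 * m * K s) ^ 2
          = (2 * m * Real.sin (s / 2) ^ 2 * K s) ^ 2 := by ring
        _ = Real.sin (M * s / 2) ^ 2 * Real.sin ((2 * m : ℕ) * s / 2) ^ 2 := by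
          rw [hK, e]; ring
        _ = Real.sin (s / 2) ^ 4 * (fejerSum M s * fejerSum (2 * m) s) := by
          rw [← sin_sq_mul_fejerSum, ← sin_sq_mul_fejerSum]; ring
  rw [← Real.sqrt_mul (fejerSum_nonneg _ _), ← hsq, Real.sqrt_sq_eq_abs, abs_mul,
    abs_of_pos (by positivity : (0 : ℝ) < 2 * m)]
  field_simp

theorem sum_abs_kernel_le (n m M e : ℕ) (hm : 0 < m) (hmM : 2 * m ≤ M) (he : e ≤ 1)
    (hn : 2 * n < M + e) (hnM : n ≤ M) (K : ℝ → ℝ) (hKc : Continuous K)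
    (hK : ∀ s, 2 * m * Real.sin (s / 2) ^ 2 * K s = Real.sin (M * s / 2) * Real.sin (m * s))
    (t : ℝ) :
    ∑ k ∈ Finset.Icc 1 n,
        (|K (t - (2 * k - e) * π / M)| + |K (t + (2 * k - e) * π / M)|) / M
      ≤ √(M / (2 * m)) := by
  have hM : 0 < M := by omega
  have hMr : (0 : ℝ) < M := by positivity
  have hmr : (0 : ℝ) < m := by positivity
  have habs := abs_kernel_eq M m hm K hKc hK
  have hper (s : ℝ) : |K (s + 2 * π)| = |K s| := by
    simp only [habs, fejerSum_add_two_pi]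
  have h1 := sum_symm_nodes_le n M e he hn hnM (fun s => |K s|) (fun s => abs_nonneg _) hper hM t
  have h2 := sum_sqrt_fejerSum_equispaced_le M (2 * m) hM hmM (t + e * π / M - 2 * π / M)
  have h3 : ∑ i ∈ Finset.range M, |K (t + e * π / M - 2 * π * (i + 1 : ℕ) / M)|
      ≤ M * √((2 * m : ℕ) * M) / (2 * m) := by
    simp only [habs]
    rw [← Finset.sum_div]
    refine div_le_div_of_nonneg_right (le_trans (le_of_eq ?_) h2) (by positivity)
    refine Finset.sum_congr rfl fun i _ => ?_
    have : t + e * π / M - 2 * π * (i + 1 : ℕ) / M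
        = t + e * π / M - 2 * π / M - 2 * π * i / M := by push_cast; ring
    rw [this]
  rw [← Finset.sum_div, div_le_iff₀ hMr]
  refine h1.trans (h3.trans (le_of_eq ?_))
  have h5 : ((2 * m : ℕ) : ℝ) * M = (M / (2 * m)) * (2 * m) ^ 2 := by
    push_cast; field_simp
  rw [h5, Real.sqrt_mul (by positivity), Real.sqrt_sq (by positivity)]
  field_simp

theorem sin_sq_mul_sum_cos (b s : ℝ) (r : ℕ) :
    4 * Real.sin (s / 2) ^ 2 * ∑ i ∈ Finset.range r, Real.cos ((i + b) * s)
      = Real.cos (b * s) - Real.cos ((b - 1) * s)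
        - (Real.cos ((r + b) * s) - Real.cos ((r + b - 1) * s)) := by
  have hh : 4 * Real.sin (s / 2) ^ 2 = 2 - 2 * Real.cos s := by
    linarith [cos_eq_one_sub_two_mul_sin_half_sq s]
  induction r with
  | zero => simp
  | succ r ih =>
    rw [Finset.sum_range_succ, mul_add, ih, hh]
    have e1 : ((r + 1 : ℕ) + b) * s = (r + b) * s + s := by push_cast; ring
    have e2 : ((r + 1 : ℕ) + b - 1) * s = (r + b) * s := by push_cast; ring
    have e3 : (r + b - 1) * s = (r + b) * s - s := by ring
    rw [e1, e2, e3, Real.cos_add, Real.cos_sub]; ring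

theorem sin_sq_mul_sum_linear_cos (b s : ℝ) (L : ℕ) :
    4 * Real.sin (s / 2) ^ 2 * ∑ i ∈ Finset.range L, ((L : ℝ) - i) * Real.cos ((i + b) * s)
      = L * (Real.cos (b * s) - Real.cos ((b - 1) * s))
        - Real.cos ((L + b) * s) + Real.cos (b * s) := by
  induction L with
  | zero => simp
  | succ L ih =>
    have h : ∑ i ∈ Finset.range (L + 1), (((L + 1 : ℕ) : ℝ) - i) * Real.cos ((i + b) * s)
        = ∑ i ∈ Finset.range L, ((L : ℝ) - i) * Real.cos ((i + b) * s)
          + ∑ i ∈ Finset.range (L + 1), Real.cos ((i + b) * s) := by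
      rw [Finset.sum_range_succ, Finset.sum_range_succ, ← add_assoc, ← Finset.sum_add_distrib]
      congr 1
      · refine Finset.sum_congr rfl fun i _ => ?_
        push_cast; ring
      · push_cast; ring
    rw [h, mul_add, ih, sin_sq_mul_sum_cos]
    have e : ((L + 1 : ℕ) + b - 1) * s = (L + b) * s := by push_cast; ring
    rw [e]; push_cast; ring

theorem sin_sq_mul_sum_mufilt (n m : ℕ) (hm : 0 < m) (hmn : m < n) (δ s : ℝ) :
    2 * m * Real.sin (s / 2) ^ 2 *
        (2 * ∑ j ∈ Finset.range (n + m), mufilt n m j * Real.cos ((j + δ) * s))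
      = Real.sin ((n + δ) * s) * Real.sin (m * s)
        + m * (Real.cos (δ * s) - Real.cos ((δ - 1) * s)) := by
  obtain ⟨a, rfl⟩ : ∃ a, n = a + m := ⟨n - m, by omega⟩
  have hmr : (m : ℝ) ≠ 0 := by positivity
  have hr : a + m + m = a + 2 * m := by ring
  have h1 : ∑ j ∈ Finset.range a, mufilt (a + m) m j * Real.cos ((j + δ) * s)
      = ∑ j ∈ Finset.range a, Real.cos ((j + δ) * s) := by
    refine Finset.sum_congr rfl fun j hj => ?_
    rw [Finset.mem_range] at hj
    rw [mufilt, if_pos (by omega), one_mul]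
  have h2 : 2 * m * ∑ i ∈ Finset.range (2 * m),
        mufilt (a + m) m (a + i) * Real.cos (((a + i : ℕ) + δ) * s)
      = ∑ i ∈ Finset.range (2 * m), (((2 * m : ℕ) : ℝ) - i) * Real.cos ((i + (a + δ)) * s) := by
    rw [Finset.mul_sum]
    refine Finset.sum_congr rfl fun i _ => ?_
    have e : ((a + i : ℕ) + δ) * s = (i + (a + δ)) * s := by push_cast; ring
    rw [e, mufilt]
    split_ifs with h
    · obtain rfl : i = 0 := by omega
      push_cast; ring
    · push_cast; field_simp; ring
  have h3 := sin_sq_mul_sum_cos δ s a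
  have h4 := sin_sq_mul_sum_linear_cos (a + δ) s (2 * m)
  rw [← h2] at h4
  have h5 : Real.cos ((a + δ) * s) - Real.cos (((2 * m : ℕ) + (a + δ)) * s)
      = 2 * (Real.sin (((a + m : ℕ) + δ) * s) * Real.sin (m * s)) := by
    have e1 : (a + δ) * s = ((a + m : ℕ) + δ) * s - m * s := by push_cast; ring
    have e2 : ((2 * m : ℕ) + (a + δ)) * s = ((a + m : ℕ) + δ) * s + m * s := by push_cast; ring
    rw [e1, e2, Real.cos_sub, Real.cos_add]; ring
  rw [hr, Finset.sum_range_add, h1]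
  push_cast at h3 h4 h5 ⊢
  linear_combination m * h3 + h4 / 2 + h5 / 2

theorem cos_half_mul_eval_U_sub (t : ℝ) (j : ℕ) :
    Real.cos (t / 2) * ((Polynomial.Chebyshev.U ℝ (j : ℤ)).eval (Real.cos t)
        - (Polynomial.Chebyshev.U ℝ ((j : ℤ) - 1)).eval (Real.cos t))
      = Real.cos ((j + 1 / 2) * t) := by
  induction j using Nat.twoStepInduction with
  | zero =>
    simp
    congr 1; ring
  | one =>
    have e : ((1 : ℕ) + 1 / 2 : ℝ) * t = t + t / 2 := by push_cast; ring
    have h1 := Real.cos_sub t (t / 2)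
    have e2 : t - t / 2 = t / 2 := by ring
    rw [e2] at h1
    rw [e, Real.cos_add]
    simp
    linear_combination -h1
  | more j ih1 ih2 =>
    have h1 := congrArg (Polynomial.eval (Real.cos t)) (Polynomial.Chebyshev.U_add_two ℝ (j : ℤ))
    have h2 := congrArg (Polynomial.eval (Real.cos t))
      (Polynomial.Chebyshev.U_add_two ℝ ((j : ℤ) - 1))
    have e1 : ((j : ℤ) - 1 + 2) = j + 1 := by ring
    have e2 : ((j : ℤ) - 1 + 1) = j := by ring
    have e3 : (((j + 2 : ℕ) : ℤ) - 1) = j + 1 := by push_cast; ring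
    have e4 : ((j + 2 : ℕ) : ℤ) = j + 2 := by push_cast; ring
    have e5 : (((j + 1 : ℕ) : ℤ) - 1) = j := by push_cast; ring
    have e6 : ((j + 1 : ℕ) : ℤ) = j + 1 := by push_cast; ring
    rw [e5, e6] at ih2
    rw [e1, e2] at h2
    rw [e3, e4]
    simp only [Polynomial.eval_sub, Polynomial.eval_mul, Polynomial.eval_ofNat,
      Polynomial.eval_X] at h1 h2
    have a1 : ((j + 2 : ℕ) + 1 / 2 : ℝ) * t = ((j + 1 : ℕ) + 1 / 2 : ℝ) * t + t := by
      push_cast; ring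
    have a2 : ((j : ℝ) + 1 / 2) * t = ((j + 1 : ℕ) + 1 / 2 : ℝ) * t - t := by
      push_cast; ring
    rw [a2, Real.cos_sub] at ih1
    rw [a1, Real.cos_add, h1]
    linear_combination 2 * Real.cos t * ih2 - ih1 - Real.cos (t / 2) * h2

theorem sin_half_mul_eval_U_add (t : ℝ) (j : ℕ) :
    Real.sin (t / 2) * ((Polynomial.Chebyshev.U ℝ (j : ℤ)).eval (Real.cos t)
        + (Polynomial.Chebyshev.U ℝ ((j : ℤ) - 1)).eval (Real.cos t))
      = Real.sin ((j + 1 / 2) * t) := by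
  induction j using Nat.twoStepInduction with
  | zero =>
    simp
    congr 1; ring
  | one =>
    have e : ((1 : ℕ) + 1 / 2 : ℝ) * t = t + t / 2 := by push_cast; ring
    have h1 := Real.sin_sub t (t / 2)
    have e2 : t - t / 2 = t / 2 := by ring
    rw [e2] at h1
    rw [e, Real.sin_add]
    simp
    linear_combination h1
  | more j ih1 ih2 =>
    have h1 := congrArg (Polynomial.eval (Real.cos t)) (Polynomial.Chebyshev.U_add_two ℝ (j : ℤ))
    have h2 := congrArg (Polynomial.eval (Real.cos t))
      (Polynomial.Chebyshev.U_add_two ℝ ((j : ℤ) - 1))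
    have e1 : ((j : ℤ) - 1 + 2) = j + 1 := by ring
    have e2 : ((j : ℤ) - 1 + 1) = j := by ring
    have e3 : (((j + 2 : ℕ) : ℤ) - 1) = j + 1 := by push_cast; ring
    have e4 : ((j + 2 : ℕ) : ℤ) = j + 2 := by push_cast; ring
    have e5 : (((j + 1 : ℕ) : ℤ) - 1) = j := by push_cast; ring
    have e6 : ((j + 1 : ℕ) : ℤ) = j + 1 := by push_cast; ring
    rw [e5, e6] at ih2
    rw [e1, e2] at h2
    rw [e3, e4]
    simp only [Polynomial.eval_sub, Polynomial.eval_mul, Polynomial.eval_ofNat,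
      Polynomial.eval_X] at h1 h2
    have a1 : ((j + 2 : ℕ) + 1 / 2 : ℝ) * t = ((j + 1 : ℕ) + 1 / 2 : ℝ) * t + t := by
      push_cast; ring
    have a2 : ((j : ℝ) + 1 / 2) * t = ((j + 1 : ℕ) + 1 / 2 : ℝ) * t - t := by
      push_cast; ring
    rw [a2, Real.sin_sub] at ih1
    rw [a1, Real.sin_add, h1]
    linear_combination 2 * Real.cos t * ih2 - ih1 + Real.sin (t / 2) * h2

/-- The de la Vallée Poussin kernel `sin (n + δ)s sin ms / (2m sin² (s/2))` as a cosine sum; it has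
this closed form for `δ = 0, 1/2, 1`. -/
noncomputable def vpKernel (n m : ℕ) (δ s : ℝ) : ℝ :=
  2 * ∑ j ∈ Finset.range (n + m), mufilt n m j * Real.cos ((j + δ) * s) + (2 * δ - 1)

theorem continuous_vpKernel (n m : ℕ) (δ : ℝ) : Continuous (vpKernel n m δ) := by
  unfold vpKernel; fun_prop

theorem sin_sq_mul_vpKernel (n m : ℕ) (hm : 0 < m) (hmn : m < n) (δ : ℝ)
    (hδ : δ = 0 ∨ δ = 1 / 2 ∨ δ = 1) (s : ℝ) :
    2 * m * Real.sin (s / 2) ^ 2 * vpKernel n m δ s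
      = Real.sin ((n + δ) * s) * Real.sin (m * s) := by
  rw [vpKernel, mul_add, sin_sq_mul_sum_mufilt n m hm hmn]
  have h := cos_eq_one_sub_two_mul_sin_half_sq s
  rcases hδ with rfl | rfl | rfl
  · simp; linear_combination -m * h
  · have : (1 / 2 - 1 : ℝ) * s = -(1 / 2 * s) := by ring
    rw [this, Real.cos_neg]; ring
  · simp; linear_combination m * h

theorem vpKernel_sub_add (n m : ℕ) (δ a b : ℝ) :
    vpKernel n m δ (a - b) + vpKernel n m δ (a + b)
      = 4 * ∑ j ∈ Finset.range (n + m), mufilt n m j *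
          (Real.cos ((j + δ) * b) * Real.cos ((j + δ) * a)) + 2 * (2 * δ - 1) := by
  have h : ∑ j ∈ Finset.range (n + m), mufilt n m j * Real.cos ((j + δ) * (a - b))
      + ∑ j ∈ Finset.range (n + m), mufilt n m j * Real.cos ((j + δ) * (a + b))
      = 2 * ∑ j ∈ Finset.range (n + m), mufilt n m j *
          (Real.cos ((j + δ) * b) * Real.cos ((j + δ) * a)) := by
    rw [← Finset.sum_add_distrib, Finset.mul_sum]
    refine Finset.sum_congr rfl fun j _ => ?_
    rw [mul_sub, mul_add, Real.cos_sub, Real.cos_add]; ring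
  rw [vpKernel, vpKernel]; linear_combination 2 * h

theorem vpKernel_sub_sub (n m : ℕ) (δ a b : ℝ) :
    vpKernel n m δ (a - b) - vpKernel n m δ (a + b)
      = 4 * ∑ j ∈ Finset.range (n + m), mufilt n m j *
          (Real.sin ((j + δ) * b) * Real.sin ((j + δ) * a)) := by
  have h : ∑ j ∈ Finset.range (n + m), mufilt n m j * Real.cos ((j + δ) * (a - b))
      - ∑ j ∈ Finset.range (n + m), mufilt n m j * Real.cos ((j + δ) * (a + b))
      = 2 * ∑ j ∈ Finset.range (n + m), mufilt n m j *
          (Real.sin ((j + δ) * b) * Real.sin ((j + δ) * a)) := by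
    rw [← Finset.sum_sub_distrib, Finset.mul_sum]
    refine Finset.sum_congr rfl fun j _ => ?_
    rw [mul_sub, mul_add, Real.cos_sub, Real.cos_add]; ring
  rw [vpKernel, vpKernel]; linear_combination 2 * h

theorem jac_half_half_cos {t : ℝ} (h0 : 0 ≤ t) (hπ : t ≤ π) :
    jac (1 / 2) (1 / 2) (Real.cos t) = Real.sin t := by
  have h1 : 0 ≤ 1 - Real.cos t := by linarith [Real.cos_le_one t]
  have h : (1 - Real.cos t) * (1 + Real.cos t) = Real.sin t ^ 2 := by
    linear_combination -Real.sin_sq_add_cos_sq t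
  rw [jac, ← Real.sqrt_eq_rpow, ← Real.sqrt_eq_rpow, ← Real.sqrt_mul h1, h,
    Real.sqrt_sq (Real.sin_nonneg_of_nonneg_of_le_pi h0 hπ)]

theorem jac_zero_half_cos {t : ℝ} (h0 : 0 ≤ t) (hπ : t ≤ π) :
    jac 0 (1 / 2) (Real.cos t) = √2 * Real.cos (t / 2) := by
  have h2 : 0 ≤ Real.cos (t / 2) := Real.cos_nonneg_of_neg_pi_div_two_le_of_le
    (by linarith [Real.pi_pos]) (by linarith)
  have h : 1 + Real.cos t = 2 * Real.cos (t / 2) ^ 2 := by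
    linear_combination cos_eq_one_sub_two_mul_sin_half_sq t
      - 2 * Real.sin_sq_add_cos_sq (t / 2)
  rw [jac, Real.rpow_zero, one_mul, ← Real.sqrt_eq_rpow, h, Real.sqrt_mul zero_le_two,
    Real.sqrt_sq h2]

theorem jac_half_zero_cos {t : ℝ} (h0 : 0 ≤ t) (hπ : t ≤ π) :
    jac (1 / 2) 0 (Real.cos t) = √2 * Real.sin (t / 2) := by
  have h2 : 0 ≤ Real.sin (t / 2) := Real.sin_nonneg_of_nonneg_of_le_pi
    (by linarith) (by linarith [Real.pi_pos])
  have h : 1 - Real.cos t = 2 * Real.sin (t / 2) ^ 2 := by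
    linear_combination -cos_eq_one_sub_two_mul_sin_half_sq t
  rw [jac, Real.rpow_zero, mul_one, ← Real.sqrt_eq_rpow, h, Real.sqrt_mul zero_le_two,
    Real.sqrt_sq h2]

theorem Phi_one_cos (n m k : ℕ) (hm : 0 < m) (t : ℝ) :
    Phi .one n m k (Real.cos t)
      = (vpKernel n m 0 (t - tNode .one n k) + vpKernel n m 0 (t + tNode .one n k)) / (2 * n) := by
  have hpi := Real.pi_pos
  obtain ⟨r, hr⟩ : ∃ r, n + m = r + 1 := ⟨n + m - 1, by omega⟩
  have h0 : mufilt n m 0 = 1 := by simp [mufilt]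
  have hs1 : √(2 / π) ^ 2 = 2 / π := Real.sq_sqrt (by positivity)
  have hs2 : (1 / √π) ^ 2 = 1 / π := by rw [div_pow, Real.sq_sqrt hpi.le, one_pow]
  have hp0 (s : ℝ) : pEval .one 0 (Real.cos s) = 1 / √π := by simp [pEval, pPoly]
  have hp (j : ℕ) (s : ℝ) :
      pEval .one (j + 1) (Real.cos s) = √(2 / π) * Real.cos ((j + 1) * s) := by
    have := Polynomial.Chebyshev.T_real_cos s ((j : ℤ) + 1)
    push_cast at this
    simp [pEval, pPoly, this]
  rw [vpKernel_sub_add, Phi, lam, xNode, hr, Finset.sum_range_succ', Finset.sum_range_succ', h0,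
    hp0, hp0]
  have hsum : ∑ j ∈ Finset.range r, mufilt n m (j + 1) *
        pEval .one (j + 1) (Real.cos (tNode .one n k)) * pEval .one (j + 1) (Real.cos t)
      = 2 / π * ∑ j ∈ Finset.range r, mufilt n m (j + 1) *
        (Real.cos (((j + 1 : ℕ) + 0) * tNode .one n k) * Real.cos (((j + 1 : ℕ) + 0) * t)) := by
    rw [Finset.mul_sum, ← hs1]
    refine Finset.sum_congr rfl fun j _ => ?_
    rw [hp, hp]; push_cast; simp only [add_zero]; ring
  have h1 : (1 : ℝ) * (1 / √π) * (1 / √π) = 1 / π := by rw [← hs2]; ring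
  rw [hsum, h1]
  generalize (Finset.sum (M := ℝ) (ι := ℕ) _ _) = S
  simp only [Nat.cast_zero, zero_add, zero_mul, Real.cos_zero]
  field_simp
  ring

theorem Phi_two_cos (n m k : ℕ) (t : ℝ) (hk : Real.sin (tNode .two n k) ≠ 0) :
    Phi .two n m k (Real.cos t) * Real.sin t / Real.sin (tNode .two n k)
      = (vpKernel n m 1 (t - tNode .two n k) - vpKernel n m 1 (t + tNode .two n k))
          / (2 * n + 2) := by
  have hpi := Real.pi_pos
  have hs1 : √(2 / π) ^ 2 = 2 / π := Real.sq_sqrt (by positivity)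
  have hp (j : ℕ) (s : ℝ) :
      pEval .two j (Real.cos s) * Real.sin s = √(2 / π) * Real.sin ((j + 1) * s) := by
    have := Polynomial.Chebyshev.U_real_cos s (j : ℤ)
    push_cast at this
    rw [← this]
    simp [pEval, pPoly, mul_assoc]
  rw [vpKernel_sub_sub, Phi, lam, xNode]
  have hsum : (∑ j ∈ Finset.range (n + m), mufilt n m j *
        pEval .two j (Real.cos (tNode .two n k)) * pEval .two j (Real.cos t))
          * Real.sin (tNode .two n k) * Real.sin t
      = 2 / π * ∑ j ∈ Finset.range (n + m), mufilt n m j *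
        (Real.sin ((j + 1) * tNode .two n k) * Real.sin ((j + 1) * t)) := by
    rw [Finset.mul_sum, ← hs1, Finset.sum_mul, Finset.sum_mul]
    refine Finset.sum_congr rfl fun j _ => ?_
    linear_combination mufilt n m j * pEval .two j (Real.cos t) * Real.sin t * hp j (tNode .two n k)
      + mufilt n m j * √(2 / π) * Real.sin ((j + 1) * tNode .two n k) * hp j t
  rw [div_eq_iff hk]
  calc _ = π / (n + 1) * Real.sin (tNode .two n k) * ((∑ j ∈ Finset.range (n + m), mufilt n m j *
        pEval .two j (Real.cos (tNode .two n k)) * pEval .two j (Real.cos t))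
          * Real.sin (tNode .two n k) * Real.sin t) := by ring
    _ = _ := by
      rw [hsum]
      generalize (Finset.sum (M := ℝ) (ι := ℕ) _ _) = S
      field_simp
      ring

theorem Phi_three_cos (n m k : ℕ) (t : ℝ) (hk : Real.cos (tNode .three n k / 2) ≠ 0) :
    Phi .three n m k (Real.cos t) * Real.cos (t / 2) / Real.cos (tNode .three n k / 2)
      = (vpKernel n m (1 / 2) (t - tNode .three n k) + vpKernel n m (1 / 2) (t + tNode .three n k))
          / (2 * n + 1) := by
  have hpi := Real.pi_pos
  have hs1 : (1 / √π) ^ 2 = 1 / π := by rw [div_pow, Real.sq_sqrt hpi.le, one_pow]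
  have hp (j : ℕ) (s : ℝ) :
      pEval .three j (Real.cos s) * Real.cos (s / 2) = 1 / √π * Real.cos ((j + 1 / 2) * s) := by
    rw [← cos_half_mul_eval_U_sub]
    simp only [pEval, pPoly, Polynomial.eval_mul, Polynomial.eval_C, Polynomial.eval_sub]
    ring
  rw [vpKernel_sub_add, Phi, lam, xNode]
  have hsum : (∑ j ∈ Finset.range (n + m), mufilt n m j *
        pEval .three j (Real.cos (tNode .three n k)) * pEval .three j (Real.cos t))
          * Real.cos (tNode .three n k / 2) * Real.cos (t / 2)
      = 1 / π * ∑ j ∈ Finset.range (n + m), mufilt n m j *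
        (Real.cos ((j + 1 / 2) * tNode .three n k) * Real.cos ((j + 1 / 2) * t)) := by
    rw [Finset.mul_sum, ← hs1, Finset.sum_mul, Finset.sum_mul]
    refine Finset.sum_congr rfl fun j _ => ?_
    linear_combination
      mufilt n m j * pEval .three j (Real.cos t) * Real.cos (t / 2) * hp j (tNode .three n k)
      + mufilt n m j * (1 / √π) * Real.cos ((j + 1 / 2) * tNode .three n k) * hp j t
  rw [div_eq_iff hk]
  calc _ = 4 * π / (2 * n + 1) * Real.cos (tNode .three n k / 2) *
        ((∑ j ∈ Finset.range (n + m), mufilt n m j *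
        pEval .three j (Real.cos (tNode .three n k)) * pEval .three j (Real.cos t))
          * Real.cos (tNode .three n k / 2) * Real.cos (t / 2)) := by ring
    _ = _ := by
      rw [hsum]
      generalize (Finset.sum (M := ℝ) (ι := ℕ) _ _) = S
      field_simp
      ring

theorem Phi_four_cos (n m k : ℕ) (t : ℝ) (hk : Real.sin (tNode .four n k / 2) ≠ 0) :
    Phi .four n m k (Real.cos t) * Real.sin (t / 2) / Real.sin (tNode .four n k / 2)
      = (vpKernel n m (1 / 2) (t - tNode .four n k) - vpKernel n m (1 / 2) (t + tNode .four n k))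
          / (2 * n + 1) := by
  have hpi := Real.pi_pos
  have hs1 : (1 / √π) ^ 2 = 1 / π := by rw [div_pow, Real.sq_sqrt hpi.le, one_pow]
  have hp (j : ℕ) (s : ℝ) :
      pEval .four j (Real.cos s) * Real.sin (s / 2) = 1 / √π * Real.sin ((j + 1 / 2) * s) := by
    rw [← sin_half_mul_eval_U_add]
    simp only [pEval, pPoly, Polynomial.eval_mul, Polynomial.eval_C, Polynomial.eval_add]
    ring
  rw [vpKernel_sub_sub, Phi, lam, xNode]
  have hsum : (∑ j ∈ Finset.range (n + m), mufilt n m j *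
        pEval .four j (Real.cos (tNode .four n k)) * pEval .four j (Real.cos t))
          * Real.sin (tNode .four n k / 2) * Real.sin (t / 2)
      = 1 / π * ∑ j ∈ Finset.range (n + m), mufilt n m j *
        (Real.sin ((j + 1 / 2) * tNode .four n k) * Real.sin ((j + 1 / 2) * t)) := by
    rw [Finset.mul_sum, ← hs1, Finset.sum_mul, Finset.sum_mul]
    refine Finset.sum_congr rfl fun j _ => ?_
    linear_combination
      mufilt n m j * pEval .four j (Real.cos t) * Real.sin (t / 2) * hp j (tNode .four n k)
      + mufilt n m j * (1 / √π) * Real.sin ((j + 1 / 2) * tNode .four n k) * hp j t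
  rw [div_eq_iff hk]
  calc _ = 4 * π / (2 * n + 1) * Real.sin (tNode .four n k / 2) *
        ((∑ j ∈ Finset.range (n + m), mufilt n m j *
        pEval .four j (Real.cos (tNode .four n k)) * pEval .four j (Real.cos t))
          * Real.sin (tNode .four n k / 2) * Real.sin (t / 2)) := by ring
    _ = _ := by
      rw [hsum]
      generalize (Finset.sum (M := ℝ) (ι := ℕ) _ _) = S
      field_simp

/-- The weighted Lebesgue function is at most `√(n_w / m)`. -/
theorem lebesgue_sum_le (w : ChebKind) (n m : ℕ) (hm : 0 < m) (hmn : m < n) {t : ℝ}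
    (h0 : 0 ≤ t) (hπ : t ≤ π) :
    ∑ k ∈ Finset.Icc 1 n,
        |Phi w n m k (Real.cos t)| * jac (uExp w).1 (uExp w).2 (Real.cos t)
          / jac (uExp w).1 (uExp w).2 (xNode w n k)
      ≤ √(nw w n / m) := by
  have hpi := Real.pi_pos
  have hmr : (0 : ℝ) < m := by positivity
  have hn : (0 : ℝ) < n := by exact_mod_cast hm.trans hmn
  cases w with
  | one =>
    have h := sum_abs_kernel_le n m (2 * n) 1 hm (by omega) le_rfl (by omega) (by omega)
      (vpKernel n m 0) (continuous_vpKernel n m 0) (fun s => by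
        rw [sin_sq_mul_vpKernel n m hm hmn 0 (by simp)]
        congr 2; push_cast; ring) t
    have e : ((2 * n : ℕ) : ℝ) / (2 * m) = n / m := by push_cast; field_simp
    rw [e] at h
    refine le_trans (Finset.sum_le_sum fun k hk => ?_) h
    have eτ : (2 * k - (1 : ℕ)) * π / (2 * n : ℕ) = tNode .one n k := by
      simp only [tNode]; push_cast; ring
    rw [eτ]
    simp only [uExp, jac, Real.rpow_zero, mul_one, div_one]
    rw [Phi_one_cos n m k hm, abs_div, abs_of_pos (by positivity : (0 : ℝ) < 2 * n)]
    push_cast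
    gcongr
    exact abs_add_le _ _
  | two =>
    have h := sum_abs_kernel_le n m (2 * n + 2) 0 hm (by omega) zero_le_one (by omega) (by omega)
      (vpKernel n m 1) (continuous_vpKernel n m 1) (fun s => by
        rw [sin_sq_mul_vpKernel n m hm hmn 1 (by simp)]
        congr 2; push_cast; ring) t
    have e : ((2 * n + 2 : ℕ) : ℝ) / (2 * m) = (n + 1) / m := by push_cast; field_simp
    rw [e] at h
    refine le_trans (Finset.sum_le_sum fun k hk => ?_) h
    have eτ : (2 * k - (0 : ℕ)) * π / (2 * n + 2 : ℕ) = tNode .two n k := by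
      simp only [tNode]; push_cast; field_simp; ring
    rw [Finset.mem_Icc] at hk
    have hk1 : (1 : ℝ) ≤ k := by exact_mod_cast hk.1
    have hk2 : (k : ℝ) ≤ n := by exact_mod_cast hk.2
    have hτ0 : 0 < tNode .two n k := by simp only [tNode]; positivity
    have hτπ : tNode .two n k < π := by
      simp only [tNode]; rw [div_lt_iff₀ (by positivity)]; nlinarith
    have hsin := Real.sin_pos_of_pos_of_lt_pi hτ0 hτπ
    rw [eτ]
    simp only [uExp, xNode]
    rw [jac_half_half_cos h0 hπ, jac_half_half_cos hτ0.le hτπ.le]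
    have hsin_t := Real.sin_nonneg_of_nonneg_of_le_pi h0 hπ
    rw [← abs_of_nonneg hsin_t, ← abs_of_pos hsin, ← abs_mul, ← abs_div,
      Phi_two_cos n m k t hsin.ne', abs_div,
      abs_of_pos (by positivity : (0 : ℝ) < 2 * n + 2)]
    push_cast
    gcongr
    exact abs_sub _ _
  | three =>
    have h := sum_abs_kernel_le n m (2 * n + 1) 1 hm (by omega) le_rfl (by omega) (by omega)
      (vpKernel n m (1 / 2)) (continuous_vpKernel n m (1 / 2)) (fun s => by
        rw [sin_sq_mul_vpKernel n m hm hmn (1 / 2) (by simp)]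
        congr 2; push_cast; ring) t
    have e : ((2 * n + 1 : ℕ) : ℝ) / (2 * m) = (2 * n + 1) / 2 / m := by push_cast; field_simp
    rw [e] at h
    refine le_trans (Finset.sum_le_sum fun k hk => ?_) h
    have eτ : (2 * k - (1 : ℕ)) * π / (2 * n + 1 : ℕ) = tNode .three n k := by
      simp only [tNode]; push_cast; ring
    rw [Finset.mem_Icc] at hk
    have hk1 : (1 : ℝ) ≤ k := by exact_mod_cast hk.1
    have hk2 : (k : ℝ) ≤ n := by exact_mod_cast hk.2
    have hτ0 : 0 < tNode .three n k := by
      simp only [tNode]; exact div_pos (mul_pos (by linarith) hpi) (by positivity)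
    have hτπ : tNode .three n k < π := by
      simp only [tNode]; rw [div_lt_iff₀ (by positivity)]; nlinarith
    have hcos : 0 < Real.cos (tNode .three n k / 2) :=
      Real.cos_pos_of_mem_Ioo ⟨by linarith, by linarith⟩
    have hcos_t : 0 ≤ Real.cos (t / 2) :=
      Real.cos_nonneg_of_neg_pi_div_two_le_of_le (by linarith) (by linarith)
    rw [eτ]
    simp only [uExp, xNode]
    rw [jac_zero_half_cos h0 hπ, jac_zero_half_cos hτ0.le hτπ.le, mul_left_comm,
      mul_div_mul_left _ _ (by positivity : √(2 : ℝ) ≠ 0)]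
    rw [← abs_of_nonneg hcos_t, ← abs_of_pos hcos, ← abs_mul, ← abs_div,
      Phi_three_cos n m k t hcos.ne', abs_div,
      abs_of_pos (by positivity : (0 : ℝ) < 2 * n + 1)]
    push_cast
    gcongr
    exact abs_add_le _ _
  | four =>
    have h := sum_abs_kernel_le n m (2 * n + 1) 0 hm (by omega) zero_le_one (by omega) (by omega)
      (vpKernel n m (1 / 2)) (continuous_vpKernel n m (1 / 2)) (fun s => by
        rw [sin_sq_mul_vpKernel n m hm hmn (1 / 2) (by simp)]
        congr 2; push_cast; ring) t
    have e : ((2 * n + 1 : ℕ) : ℝ) / (2 * m) = (2 * n + 1) / 2 / m := by push_cast; field_simp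
    rw [e] at h
    refine le_trans (Finset.sum_le_sum fun k hk => ?_) h
    have eτ : (2 * k - (0 : ℕ)) * π / (2 * n + 1 : ℕ) = tNode .four n k := by
      simp only [tNode]; push_cast; ring
    rw [Finset.mem_Icc] at hk
    have hk1 : (1 : ℝ) ≤ k := by exact_mod_cast hk.1
    have hk2 : (k : ℝ) ≤ n := by exact_mod_cast hk.2
    have hτ0 : 0 < tNode .four n k := by simp only [tNode]; positivity
    have hτπ : tNode .four n k < π := by
      simp only [tNode]; rw [div_lt_iff₀ (by positivity)]; nlinarith
    have hsin : 0 < Real.sin (tNode .four n k / 2) :=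
      Real.sin_pos_of_pos_of_lt_pi (by linarith) (by linarith)
    have hsin_t : 0 ≤ Real.sin (t / 2) :=
      Real.sin_nonneg_of_nonneg_of_le_pi (by linarith) (by linarith)
    rw [eτ]
    simp only [uExp, xNode]
    rw [jac_half_zero_cos h0 hπ, jac_half_zero_cos hτ0.le hτπ.le, mul_left_comm,
      mul_div_mul_left _ _ (by positivity : √(2 : ℝ) ≠ 0)]
    rw [← abs_of_nonneg hsin_t, ← abs_of_pos hsin, ← abs_mul, ← abs_div,
      Phi_four_cos n m k t hsin.ne', abs_div,
      abs_of_pos (by positivity : (0 : ℝ) < 2 * n + 1)]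
    push_cast
    gcongr
    exact abs_sub _ _

/-- explicit bound on the (weighted) Lebesgue constant of `V_n^m`,
with `u = sqrt(w·φ)`. -/
theorem stmt8 (w : ChebKind) (n m : ℕ) (hm : 0 < m) (hmn : m < n) :
    ∀ x ∈ Set.Icc (-1 : ℝ) 1,
      ∑ k ∈ Finset.Icc 1 n,
          |Phi w n m k x| * jac (uExp w).1 (uExp w).2 x / jac (uExp w).1 (uExp w).2 (xNode w n k)
        ≤ Cw w * Real.sqrt (nw w n / m) * (1 + 2 * π * mw w n m / nw w n) := by
  intro x hx
  have h := lebesgue_sum_le w n m hm hmn (Real.arccos_nonneg x) (Real.arccos_le_pi x)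
  rw [Real.cos_arccos hx.1 hx.2] at h
  refine h.trans ?_
  have hn : (0 : ℝ) < n := by exact_mod_cast hm.trans hmn
  have hm1 : (1 : ℝ) ≤ m := by exact_mod_cast hm
  have hC : 1 ≤ Cw w := by cases w <;> norm_num [Cw]
  have hnw : 0 ≤ nw w n := by cases w <;> simp only [nw] <;> positivity
  have hmw : 0 ≤ mw w n m := by cases w <;> simp only [mw] <;> linarith
  have hf : 1 ≤ 1 + 2 * π * mw w n m / nw w n := by
    have : 0 ≤ 2 * π * mw w n m / nw w n := by positivity
    linarith
  calc √(nw w n / m) = 1 * √(nw w n / m) * 1 := by ring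
    _ ≤ Cw w * √(nw w n / m) * (1 + 2 * π * mw w n m / nw w n) := by gcongr
end

section
/- Let w be any one of the four Chebyshev weights and 0<m<n integers. Then for every k∈{1,…,n} and every x∈[−1,1]: Φ_{n,k}^m(w;x) = λ_k^n · Σ_{j=0}^{n−1} p_j(w,x_k^n) · q_{n,j}^m(w,x). -/
open Real Set Finset Polynomial

lemma tNode_two_mul_eq {n : ℕ} (hn : 0 < n) (k : ℕ) :
    2 * n * tNode .one n k = k * (2 * π) - π := by
  have : (n : ℝ) ≠ 0 := by positivity
  simp only [tNode]
  field_simp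

lemma tNode_two_add_two_mul_eq (n k : ℕ) :
    (2 * n + 2) * tNode .two n k = k * (2 * π) := by
  have : (n : ℝ) + 1 ≠ 0 := by positivity
  simp only [tNode]
  field_simp

lemma tNode_three_mul_eq (n k : ℕ) :
    (2 * n + 1) * tNode .three n k = k * (2 * π) - π := by
  have : 2 * (n : ℝ) + 1 ≠ 0 := by positivity
  simp only [tNode]
  field_simp

lemma tNode_four_mul_eq (n k : ℕ) :
    (2 * n + 1) * tNode .four n k = k * (2 * π) := by
  have : 2 * (n : ℝ) + 1 ≠ 0 := by positivity
  simp only [tNode]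
  field_simp

lemma sin_tNode_ne_zero (w : ChebKind) {n k : ℕ} (hk : 1 ≤ k) (hkn : k ≤ n) :
    Real.sin (tNode w n k) ≠ 0 := by
  have hk' : (1 : ℝ) ≤ k := by exact_mod_cast hk
  have hkn' : (k : ℝ) ≤ n := by exact_mod_cast hkn
  have hπ := Real.pi_pos
  refine (Real.sin_pos_of_pos_of_lt_pi ?_ ?_).ne' <;> cases w <;> simp only [tNode]
  any_goals
    apply div_pos _ (by linarith)
    apply mul_pos _ hπ
    linarith
  all_goals
    rw [div_lt_iff₀ (by linarith)]
    nlinarith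

/-- At the zeros of `p_n`, the orthonormal polynomials of degrees symmetric about `n` are
opposite. -/
lemma pEval_two_mul_sub_xNode (w : ChebKind) {n k j : ℕ} (hk : 1 ≤ k) (hkn : k ≤ n)
    (hj : 0 < j) (hjn : j ≤ n) :
    pEval w (2 * n - j) (xNode w n k) = -pEval w j (xNode w n k) := by
  have hsin := sin_tNode_ne_zero w hk hkn
  obtain ⟨l, hl⟩ : ∃ l, 2 * n - j = l + 1 := ⟨2 * n - j - 1, by omega⟩
  have hlR : (l : ℝ) = 2 * n - j - 1 := by
    have : l + 1 + j = 2 * n := by omega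
    have : (l : ℝ) + 1 + j = 2 * n := by exact_mod_cast this
    linarith
  rw [hl]
  cases w
  · obtain ⟨i, rfl⟩ : ∃ i, j = i + 1 := ⟨j - 1, by omega⟩
    have ht := tNode_two_mul_eq (n := n) (by omega) k
    simp only [pEval, pPoly, xNode, eval_mul, eval_C, Polynomial.Chebyshev.T_real_cos]
    push_cast at hlR ⊢
    have : ((l : ℝ) + 1) * tNode .one n k
        = k * (2 * π) - (π + ((i : ℝ) + 1) * tNode .one n k) := by
      rw [hlR]; linear_combination ht
    rw [this, Real.cos_nat_mul_two_pi_sub, add_comm π, Real.cos_add_pi]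
    ring
  all_goals
    apply mul_right_cancel₀ hsin
    simp only [pEval, pPoly, xNode, eval_mul, eval_C, eval_sub, eval_add, neg_mul, mul_assoc,
      sub_mul, add_mul (eval _ _), Polynomial.Chebyshev.U_real_cos]
    push_cast
    rw [← mul_neg]
    congr 1
  · have ht := tNode_two_add_two_mul_eq n k
    have : ((l : ℝ) + 1 + 1) * tNode .two n k
        = k * (2 * π) - ((j : ℝ) + 1) * tNode .two n k := by
      rw [hlR]; linear_combination ht
    rw [this, Real.sin_nat_mul_two_pi_sub]
  · have ht := tNode_three_mul_eq n k
    have h₁ : ((l : ℝ) + 1 + 1) * tNode .three n k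
        = k * (2 * π) - ((j : ℝ) * tNode .three n k + π) := by
      rw [hlR]; linear_combination ht
    have h₂ : ((l : ℝ) + 1 - 1 + 1) * tNode .three n k
        = k * (2 * π) - (((j : ℝ) + 1) * tNode .three n k + π) := by
      rw [hlR]; linear_combination ht
    rw [h₁, h₂, Real.sin_nat_mul_two_pi_sub, Real.sin_nat_mul_two_pi_sub, Real.sin_add_pi,
      Real.sin_add_pi, sub_add_cancel]
    ring
  · have ht := tNode_four_mul_eq n k
    have h₁ : ((l : ℝ) + 1 + 1) * tNode .four n k
        = k * (2 * π) - (j : ℝ) * tNode .four n k := by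
      rw [hlR]; linear_combination ht
    have h₂ : ((l : ℝ) + 1 - 1 + 1) * tNode .four n k
        = k * (2 * π) - ((j : ℝ) + 1) * tNode .four n k := by
      rw [hlR]; linear_combination ht
    rw [h₁, h₂, Real.sin_nat_mul_two_pi_sub, Real.sin_nat_mul_two_pi_sub, sub_add_cancel]
    ring

lemma pEval_xNode_self (w : ChebKind) {n k : ℕ} (hk : 1 ≤ k) (hkn : k ≤ n) :
    pEval w n (xNode w n k) = 0 := by
  have h := pEval_two_mul_sub_xNode w hk hkn (by omega) le_rfl
  rw [show 2 * n - n = n by omega] at h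
  linarith

/-- The sum over degrees in `[n, n + m)` folds back onto degrees in `(n - m, n]`. -/
lemma sum_range_add_eq_sum_reflect {n m : ℕ} (hm : 0 < m) (hmn : m < n) (f g : ℕ → ℝ)
    (hf : f n = 0) (hg : ∀ j ≤ n - m, g j = 0)
    (hfg : ∀ j, n - m < j → j < n → f (2 * n - j) = g j) :
    ∑ i ∈ Finset.range m, f (n + i) = ∑ j ∈ Finset.range n, g j := by
  obtain ⟨r, rfl⟩ : ∃ r, m = r + 1 := ⟨m - 1, by omega⟩
  obtain ⟨d, rfl⟩ : ∃ d, n = d + 1 + r := ⟨n - r - 1, by omega⟩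
  rw [Finset.sum_range_succ', Finset.sum_range_add,
    Finset.sum_eq_zero (s := Finset.range (d + 1)) fun j hj => hg j (by grind),
    add_zero, hf, add_zero, zero_add, ← Finset.sum_range_reflect (fun i => g _)]
  refine Finset.sum_congr rfl fun i hi => ?_
  rw [Finset.mem_range] at hi
  rw [← hfg _ (by omega) (by omega)]
  congr 1
  omega

/-- orthogonal expansion of the fundamental VP polynomials in the
`q`-basis. -/
theorem stmt12 (w : ChebKind) (n m : ℕ) (hm : 0 < m) (hmn : m < n) :
    ∀ k ∈ Finset.Icc 1 n, ∀ x ∈ Set.Icc (-1 : ℝ) 1,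
      Phi w n m k x = lam w n k * ∑ j ∈ Finset.range n, pEval w j (xNode w n k) * qq w n m j x := by
  intro k hk x _
  obtain ⟨hk, hkn⟩ := Finset.mem_Icc.mp hk
  rw [Phi, Finset.sum_range_add, sum_range_add_eq_sum_reflect hm hmn
    (fun j => mufilt n m j * pEval w j (xNode w n k) * pEval w j x)
    (fun j => if j ≤ n - m then 0 else
      -(((m : ℝ) + j - n) / (2 * m) * pEval w j (xNode w n k) * pEval w (2 * n - j) x)),
    ← Finset.sum_add_distrib]
  · congr 1
    refine Finset.sum_congr rfl fun j _ => ?_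
    simp only [mufilt, qq]
    split_ifs <;> ring
  · simp [pEval_xNode_self w hk hkn]
  · intro j hj
    simp [hj]
  · intro j hj hjn
    have hcast : ((2 * n - j : ℕ) : ℝ) = 2 * n - j := by
      rw [Nat.cast_sub (by omega)]
      push_cast
      ring
    simp only [mufilt, if_neg (show ¬ j ≤ n - m by omega),
      if_neg (show ¬ 2 * n - j ≤ n - m by omega), hcast,
      pEval_two_mul_sub_xNode w hk hkn (by omega : 0 < j) hjn.le]
    ring
end

section
/- Let w be any one of the four Chebyshev weights, let u, C_w, n_w, m_w be as specified in the context, and let s>0 be a real number. Then for all integers 0<m<n and every f∈Z_s(u): ‖(V_n^m f − f)·u‖ ≤ (1 + C_w·[sqrt(n_w/m) + 2π·m_w/sqrt(m·n_w)])·‖f‖_{Z_s(u)}/(n−m)^s. -/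
open Real Set Finset Polynomial

/-- The Dirichlet-type kernel `sin (k θ / 2) / sin (θ / 2)`, as a Chebyshev polynomial. -/
noncomputable def dirKer (k : ℤ) (θ : ℝ) : ℝ := (Chebyshev.U ℝ (k - 1)).eval (cos (θ / 2))

lemma dirKer_zero (θ : ℝ) : dirKer 0 θ = 0 := by
  simp [dirKer, Chebyshev.U_neg_one]

lemma dirKer_one (θ : ℝ) : dirKer 1 θ = 1 := by
  simp [dirKer, Chebyshev.U_zero]

lemma dirKer_two_mul_cos_mul (k : ℤ) (θ : ℝ) :
    2 * cos (θ / 2) * dirKer k θ = dirKer (k + 1) θ + dirKer (k - 1) θ := by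
  have h := congrArg (fun P : ℝ[X] => P.eval (cos (θ / 2))) (Chebyshev.U_add_one ℝ (k - 1))
  simp only [eval_sub, eval_mul, eval_X, eval_ofNat] at h
  simp only [dirKer]
  rw [show k + 1 - 1 = k - 1 + 1 by ring, h]
  ring

lemma dirKer_add_one_sub (k : ℤ) (θ : ℝ) :
    dirKer (k + 1) θ - dirKer (k - 1) θ = 2 * cos (k * θ / 2) := by
  have h := congrArg (fun P : ℝ[X] => P.eval (cos (θ / 2))) (Chebyshev.two_mul_T_eq_U_sub_U ℝ (k - 2))
  simp only [eval_sub, eval_mul, eval_ofNat, sub_add_cancel, Chebyshev.T_real_cos] at h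
  simp only [dirKer]
  rw [show k + 1 - 1 = k by ring, show k - 1 - 1 = k - 2 by ring, ← h, mul_div_assoc]

lemma dirKer_mul (p : ℤ) (q : ℕ) (θ : ℝ) :
    ∑ r ∈ range q, dirKer (p - q + 2 * r + 1) θ = dirKer p θ * dirKer q θ := by
  induction q using Nat.twoStepInduction with
  | zero => simp [dirKer_zero]
  | one => simp [dirKer_one]
  | more q h0 h1 =>
    have e := dirKer_two_mul_cos_mul ((q : ℤ) + 1) θ
    have h2 : dirKer p θ * dirKer ((q + 2 : ℕ) : ℤ) θ =
        2 * cos (θ / 2) * (dirKer p θ * dirKer ((q + 1 : ℕ) : ℤ) θ) - dirKer p θ * dirKer q θ := by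
      push_cast
      rw [show (q : ℤ) + 1 + 1 = q + 2 by ring, show (q : ℤ) + 1 - 1 = q by ring] at e
      linear_combination (-dirKer p θ) * e
    rw [h2, ← h0, ← h1, mul_sum]
    simp_rw [dirKer_two_mul_cos_mul]
    rw [sum_add_distrib, sum_range_succ (n := q), sum_range_succ (n := q + 1)]
    have a1 : ∀ r : ℕ, dirKer (p - ((q + 1 : ℕ) : ℤ) + 2 * r + 1 + 1) θ
        = dirKer (p - (q : ℤ) + 2 * r + 1) θ := by
      intro r; congr 1; push_cast; ring
    have a2 : ∀ r : ℕ, dirKer (p - ((q + 1 : ℕ) : ℤ) + 2 * r + 1 - 1) θ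
        = dirKer (p - ((q + 2 : ℕ) : ℤ) + 2 * r + 1) θ := by
      intro r; congr 1; push_cast; ring
    simp_rw [a1, a2]
    have a3 : dirKer (p - ((q + 2 : ℕ) : ℤ) + 2 * ((q + 1 : ℕ) : ℤ) + 1) θ
        = dirKer (p - (q : ℤ) + 2 * q + 1) θ := by
      congr 1; push_cast; ring
    rw [a3]
    ring

lemma sum_cos_equispaced_s18 (M : ℕ) (j : ℤ) (hj : j ≠ 0) (hjM : |j| < M) (x : ℝ) :
    ∑ l ∈ range M, cos (j * (x + l * (2 * π / M))) = 0 := by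
  have hM : (0 : ℝ) < M := by
    have : (0 : ℤ) < M := lt_of_le_of_lt (abs_nonneg j) hjM
    exact_mod_cast this
  have hs : sin (j * (π / M)) ≠ 0 := by
    rw [Real.sin_ne_zero_iff]
    intro k hk
    have h1 : (k : ℝ) * M = j := by
      field_simp at hk
      exact hk
    have h2 : k * M = j := by exact_mod_cast h1
    rcases eq_or_ne k 0 with rfl | hk0
    · simp at h2; exact hj h2.symm
    · have : (1 : ℤ) ≤ |k| := Int.one_le_abs hk0
      rw [← h2, abs_mul, Nat.abs_cast] at hjM
      nlinarith
  have key : ∀ l : ℕ, 2 * sin (j * (π / M)) * cos (j * (x + l * (2 * π / M))) =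
      sin (j * (x + (l + 1 : ℕ) * (2 * π / M)) - j * (π / M))
        - sin (j * (x + l * (2 * π / M)) - j * (π / M)) := by
    intro l
    rw [Real.sin_sub_sin]
    have e1 : ((j * (x + (l + 1 : ℕ) * (2 * π / M)) - j * (π / M))
        - (j * (x + l * (2 * π / M)) - j * (π / M))) / 2 = j * (π / M) := by
      push_cast; ring
    have e2 : ((j * (x + (l + 1 : ℕ) * (2 * π / M)) - j * (π / M))
        + (j * (x + l * (2 * π / M)) - j * (π / M))) / 2 = j * (x + l * (2 * π / M)) := by
      push_cast; ring
    rw [e1, e2]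
  have h0 : 2 * sin (j * (π / M)) * ∑ l ∈ range M, cos (j * (x + l * (2 * π / M))) = 0 := by
    rw [mul_sum, sum_congr rfl fun l _ => key l,
      sum_range_sub (fun l : ℕ => sin (j * (x + l * (2 * π / M)) - j * (π / M)))]
    rw [show (j : ℝ) * (x + (M : ℝ) * (2 * π / M)) - j * (π / M)
      = (j * (x + ((0 : ℕ) : ℝ) * (2 * π / M)) - j * (π / M)) + j * (2 * π) by
        field_simp; push_cast; ring]
    rw [Real.sin_add_int_mul_two_pi, sub_self]
  rcases mul_eq_zero.mp h0 with h | h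
  · exact absurd h (by simpa using hs)
  · exact h

lemma sum_dirKer_odd_equispaced (M r : ℕ) (hr : r < M) (x : ℝ) :
    ∑ l ∈ range M, dirKer (2 * r + 1) (x + l * (2 * π / M)) = M := by
  induction r with
  | zero => simp [dirKer_one]
  | succ r ih =>
    have h : ∀ θ, dirKer (2 * ((r + 1 : ℕ) : ℤ) + 1) θ
        = dirKer (2 * r + 1) θ + 2 * cos (((r + 1 : ℕ) : ℤ) * θ) := by
      intro θ
      have := dirKer_add_one_sub (2 * ((r + 1 : ℕ) : ℤ)) θ
      rw [show 2 * ((r + 1 : ℕ) : ℤ) - 1 = 2 * r + 1 by push_cast; ring] at this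
      rw [← sub_eq_iff_eq_add', this]
      congr 2
      push_cast; ring
    simp_rw [h]
    rw [sum_add_distrib, ih (by omega), ← mul_sum, sum_cos_equispaced_s18 M _ (by positivity)
      (by rw [Nat.abs_cast]; exact_mod_cast hr)]
    simp

lemma sum_sq_dirKer_equispaced (M q : ℕ) (hq : q ≤ M) (x : ℝ) :
    ∑ l ∈ range M, dirKer q (x + l * (2 * π / M)) ^ 2 = M * q := by
  have h : ∀ θ, dirKer q θ ^ 2 = ∑ r ∈ range q, dirKer (2 * r + 1) θ := by
    intro θ
    rw [sq, ← dirKer_mul]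
    simp
  simp_rw [h]
  rw [sum_comm, sum_congr rfl fun r hr =>
    sum_dirKer_odd_equispaced M r (lt_of_lt_of_le (mem_range.mp hr) hq) x]
  simp [mul_comm]

lemma sum_abs_dirKer_mul_equispaced (M q : ℕ) (hq : q ≤ M) (x : ℝ) :
    ∑ l ∈ range M, |dirKer M (x + l * (2 * π / M)) * dirKer q (x + l * (2 * π / M))|
      ≤ M * √(M * q) := by
  have h := Finset.sum_mul_sq_le_sq_mul_sq (range M)
    (fun l => |dirKer M (x + l * (2 * π / M))|) (fun l => |dirKer q (x + l * (2 * π / M))|)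
  simp only [sq_abs] at h
  rw [sum_sq_dirKer_equispaced M M le_rfl, sum_sq_dirKer_equispaced M q hq] at h
  simp_rw [abs_mul]
  refine (Real.le_sqrt_of_sq_le h).trans (le_of_eq ?_)
  rw [show (M * M * (M * q) : ℝ) = M ^ 2 * (M * q) by ring, Real.sqrt_mul (by positivity),
    Real.sqrt_sq (by positivity)]

/-- Twice the shift `a` in the frequencies `j + a` of the weighted orthonormal polynomials. -/
def twoShift : ChebKind → ℕ
  | .one => 0 | .two => 2 | .three => 1 | .four => 1

/-- Sign of the reflected term in the product-to-sum formula for the weighted polynomials. -/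
def reflSign : ChebKind → ℝ
  | .one => 1 | .two => -1 | .three => 1 | .four => -1

/-- Normalisation of the weighted orthonormal polynomials. -/
noncomputable def trigNorm : ChebKind → ℕ → ℝ
  | .one, 0 => √(1 / π)
  | _, _ => √(2 / π)

/-- The function `t ↦ p_j(w, cos t) u(cos t)` on `[0, π]`, in trigonometric form. -/
noncomputable def trigBasis : ChebKind → ℕ → ℝ → ℝ
  | .one, j, t => trigNorm .one j * cos (j * t)
  | .two, j, t => trigNorm .two j * sin ((j + 1) * t)
  | .three, j, t => trigNorm .three j * cos ((2 * j + 1) * (t / 2))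
  | .four, j, t => trigNorm .four j * sin ((2 * j + 1) * (t / 2))

/-- The weight `u = sqrt (w φ)` in the variable `t = arccos x`. -/
noncomputable def trigWeight : ChebKind → ℝ → ℝ
  | .one, _ => 1
  | .two, t => sin t
  | .three, t => √2 * cos (t / 2)
  | .four, t => √2 * sin (t / 2)

lemma sqrt_one_add_cos {t : ℝ} (h0 : 0 ≤ t) (h1 : t ≤ π) : √(1 + cos t) = √2 * cos (t / 2) := by
  have hc : 0 ≤ cos (t / 2) := cos_nonneg_of_mem_Icc ⟨by linarith [pi_pos], by linarith⟩
  rw [show 1 + cos t = 2 * cos (t / 2) ^ 2 by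
    rw [show cos t = cos (2 * (t / 2)) by ring_nf, cos_two_mul]; ring,
    Real.sqrt_mul (by norm_num), Real.sqrt_sq hc]

lemma sqrt_one_sub_cos {t : ℝ} (h0 : 0 ≤ t) (h1 : t ≤ π) : √(1 - cos t) = √2 * sin (t / 2) := by
  have hc : 0 ≤ sin (t / 2) := sin_nonneg_of_mem_Icc ⟨by linarith, by linarith⟩
  rw [show 1 - cos t = 2 * sin (t / 2) ^ 2 by
    rw [show cos t = cos (2 * (t / 2)) by ring_nf, cos_two_mul, sin_sq]; ring,
    Real.sqrt_mul (by norm_num), Real.sqrt_sq hc]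

lemma jac_cos (w : ChebKind) {t : ℝ} (h0 : 0 ≤ t) (h1 : t ≤ π) :
    jac (uExp w).1 (uExp w).2 (cos t) = trigWeight w t := by
  cases w
  · simp [jac, uExp, trigWeight]
  · simp only [jac, uExp, trigWeight]
    rw [← Real.sqrt_eq_rpow, ← Real.sqrt_eq_rpow, sqrt_one_add_cos h0 h1, sqrt_one_sub_cos h0 h1]
    have h2 : √2 * √2 = 2 := Real.mul_self_sqrt (by norm_num)
    rw [show sin t = sin (2 * (t / 2)) by ring_nf, sin_two_mul]
    linear_combination (sin (t / 2) * cos (t / 2)) * h2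
  · simp only [jac, uExp, trigWeight, rpow_zero, one_mul]
    rw [← Real.sqrt_eq_rpow, sqrt_one_add_cos h0 h1]
  · simp only [jac, uExp, trigWeight, rpow_zero, mul_one]
    rw [← Real.sqrt_eq_rpow, sqrt_one_sub_cos h0 h1]

lemma eval_U_sub_mul_cos (j : ℕ) (h : ℝ) :
    ((Chebyshev.U ℝ j).eval (cos (2 * h)) - (Chebyshev.U ℝ ((j : ℤ) - 1)).eval (cos (2 * h)))
      * cos h = cos ((2 * j + 1) * h) := by
  induction j using Nat.twoStepInduction with
  | zero => simp [Chebyshev.U_neg_one]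
  | one =>
    simp only [Nat.cast_one, Chebyshev.U_one, sub_self, Chebyshev.U_zero]
    rw [show (2 * 1 + 1 : ℝ) * h = 3 * h by ring, cos_three_mul, cos_two_mul]
    simp; ring
  | more j h0 h1 =>
    have e1 := congrArg (fun P : ℝ[X] => P.eval (cos (2 * h))) (Chebyshev.U_add_two ℝ j)
    have e2 := congrArg (fun P : ℝ[X] => P.eval (cos (2 * h))) (Chebyshev.U_add_one ℝ j)
    simp only [eval_sub, eval_mul, eval_X, eval_ofNat] at e1 e2
    push_cast at h1 ⊢
    rw [show (j : ℤ) + 1 - 1 = j by ring] at h1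
    rw [show (j : ℤ) + 2 - 1 = j + 1 by ring]
    have e3 : cos ((2 * ((j : ℝ) + 2) + 1) * h) =
        2 * cos (2 * h) * cos ((2 * ((j : ℝ) + 1) + 1) * h) - cos ((2 * (j : ℝ) + 1) * h) := by
      rw [show (2 * ((j : ℝ) + 2) + 1) * h = (2 * ((j : ℝ) + 1) + 1) * h + 2 * h by ring,
        show (2 * (j : ℝ) + 1) * h = (2 * ((j : ℝ) + 1) + 1) * h - 2 * h by ring,
        cos_add, cos_sub]
      ring
    rw [e3, ← h0, ← h1, e1]
    linear_combination -cos h * e2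

lemma eval_U_add_mul_sin (j : ℕ) (h : ℝ) :
    ((Chebyshev.U ℝ j).eval (cos (2 * h)) + (Chebyshev.U ℝ ((j : ℤ) - 1)).eval (cos (2 * h)))
      * sin h = sin ((2 * j + 1) * h) := by
  induction j using Nat.twoStepInduction with
  | zero => simp [Chebyshev.U_neg_one]
  | one =>
    simp only [Nat.cast_one, Chebyshev.U_one, sub_self, Chebyshev.U_zero]
    rw [show (2 * 1 + 1 : ℝ) * h = 3 * h by ring, sin_three_mul, cos_two_mul, cos_sq']
    simp; ring
  | more j h0 h1 =>
    have e1 := congrArg (fun P : ℝ[X] => P.eval (cos (2 * h))) (Chebyshev.U_add_two ℝ j)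
    have e2 := congrArg (fun P : ℝ[X] => P.eval (cos (2 * h))) (Chebyshev.U_add_one ℝ j)
    simp only [eval_sub, eval_mul, eval_X, eval_ofNat] at e1 e2
    push_cast at h1 ⊢
    rw [show (j : ℤ) + 1 - 1 = j by ring] at h1
    rw [show (j : ℤ) + 2 - 1 = j + 1 by ring]
    have e3 : sin ((2 * ((j : ℝ) + 2) + 1) * h) =
        2 * cos (2 * h) * sin ((2 * ((j : ℝ) + 1) + 1) * h) - sin ((2 * (j : ℝ) + 1) * h) := by
      rw [show (2 * ((j : ℝ) + 2) + 1) * h = (2 * ((j : ℝ) + 1) + 1) * h + 2 * h by ring,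
        show (2 * (j : ℝ) + 1) * h = (2 * ((j : ℝ) + 1) + 1) * h - 2 * h by ring,
        sin_add, sin_sub]
      ring
    rw [e3, ← h0, ← h1, e1]
    linear_combination sin h * e2

lemma one_div_sqrt_pi_mul_sqrt_two : 1 / √π * √2 = √(2 / π) := by
  rw [Real.sqrt_div (by norm_num)]; ring

lemma pEval_mul_trigWeight (w : ChebKind) (j : ℕ) (t : ℝ) :
    pEval w j (cos t) * trigWeight w t = trigBasis w j t := by
  cases w
  · cases j with
    | zero => simp [pEval, pPoly, trigWeight, trigBasis, trigNorm]
    | succ j =>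
      simp only [pEval, pPoly, trigWeight, trigBasis, trigNorm, eval_mul, eval_C, mul_one,
        Chebyshev.T_real_cos]
      push_cast; rfl
  · simp only [pEval, pPoly, trigWeight, trigBasis, trigNorm, eval_mul, eval_C, mul_assoc,
        Chebyshev.U_real_cos]
    push_cast; rfl
  · have h := eval_U_sub_mul_cos j (t / 2)
    rw [show 2 * (t / 2) = t by ring] at h
    simp only [pEval, pPoly, trigWeight, trigBasis, trigNorm, eval_mul, eval_C, eval_sub]
    rw [← one_div_sqrt_pi_mul_sqrt_two, ← h]
    ring
  · have h := eval_U_add_mul_sin j (t / 2)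
    rw [show 2 * (t / 2) = t by ring] at h
    simp only [pEval, pPoly, trigWeight, trigBasis, trigNorm, eval_mul, eval_C, eval_add]
    rw [← one_div_sqrt_pi_mul_sqrt_two, ← h]
    ring

lemma trigBasis_mul (w : ChebKind) (i j : ℕ) (s t : ℝ) :
    trigBasis w i s * trigBasis w j t = trigNorm w i * trigNorm w j / 2 *
      (cos (((2 * j + twoShift w) * t - (2 * i + twoShift w) * s) / 2) +
        reflSign w * cos (((2 * j + twoShift w) * t + (2 * i + twoShift w) * s) / 2)) := by
  cases w <;> simp only [trigBasis, twoShift, reflSign] <;> push_cast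
  · rw [show ((2 * j + 0) * t - (2 * i + 0) * s) / 2 = j * t - i * s by ring,
      show ((2 * j + 0) * t + (2 * i + 0) * s) / 2 = j * t + i * s by ring, cos_sub, cos_add]
    ring
  · rw [show ((2 * j + 2) * t - (2 * i + 2) * s) / 2 = (j + 1) * t - (i + 1) * s by ring,
      show ((2 * j + 2) * t + (2 * i + 2) * s) / 2 = (j + 1) * t + (i + 1) * s by ring,
      cos_sub, cos_add]
    ring
  · rw [show ((2 * j + 1) * t - (2 * i + 1) * s) / 2
        = (2 * j + 1) * (t / 2) - (2 * i + 1) * (s / 2) by ring,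
      show ((2 * j + 1) * t + (2 * i + 1) * s) / 2
        = (2 * j + 1) * (t / 2) + (2 * i + 1) * (s / 2) by ring, cos_sub, cos_add]
    ring
  · rw [show ((2 * j + 1) * t - (2 * i + 1) * s) / 2
        = (2 * j + 1) * (t / 2) - (2 * i + 1) * (s / 2) by ring,
      show ((2 * j + 1) * t + (2 * i + 1) * s) / 2
        = (2 * j + 1) * (t / 2) + (2 * i + 1) * (s / 2) by ring, cos_sub, cos_add]
    ring

lemma trigNorm_sq_of_ne_zero (w : ChebKind) {j : ℕ} (h : 2 * j + twoShift w ≠ 0) :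
    trigNorm w j ^ 2 = 2 / π := by
  have hs : √(2 / π) ^ 2 = 2 / π := Real.sq_sqrt (by positivity)
  cases w <;> cases j <;> first | exact hs | exact absurd rfl h

lemma trigNorm_sq_of_eq_zero (w : ChebKind) {j : ℕ} (h : 2 * j + twoShift w = 0) :
    trigNorm w j ^ 2 = 1 / π ∧ reflSign w = 1 := by
  have : (0 : ℝ) ≤ π⁻¹ := by positivity
  cases w <;> cases j <;> simp_all [trigNorm, twoShift, reflSign, Real.sq_sqrt]

/-- The part of the partial sums of the cosine kernels not captured by `dirKer`. -/
def kerOffset : ChebKind → ℝ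
  | .two => 1 | _ => 0

lemma sum_trigNorm_sq_mul_cos (w : ChebKind) (r : ℕ) (θ : ℝ) :
    ∑ j ∈ range (r + 1), π * trigNorm w j ^ 2 * cos ((2 * j + twoShift w) * θ / 2) =
      dirKer (2 * r + twoShift w + 1) θ - kerOffset w := by
  have hπ := pi_pos.ne'
  induction r with
  | zero =>
    cases w
    · rw [zero_add, sum_range_one, (trigNorm_sq_of_eq_zero .one (by simp [twoShift])).1]
      simp [twoShift, dirKer_one, kerOffset, hπ]
    · rw [zero_add, sum_range_one, trigNorm_sq_of_ne_zero .two (by simp [twoShift])]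
      have h := dirKer_add_one_sub 2 θ
      norm_num [dirKer_one] at h
      simp [twoShift, kerOffset]
      rw [h]
      field_simp
    · rw [zero_add, sum_range_one, trigNorm_sq_of_ne_zero .three (by simp [twoShift])]
      have h := dirKer_add_one_sub 1 θ
      norm_num [dirKer_zero] at h
      simp [twoShift, kerOffset]
      rw [h]
      field_simp
    · rw [zero_add, sum_range_one, trigNorm_sq_of_ne_zero .four (by simp [twoShift])]
      have h := dirKer_add_one_sub 1 θ
      norm_num [dirKer_zero] at h
      simp [twoShift, kerOffset]
      rw [h]
      field_simp
  | succ r ih =>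
    rw [sum_range_succ, ih, trigNorm_sq_of_ne_zero w (by omega)]
    have h := dirKer_add_one_sub (2 * ((r + 1 : ℕ) : ℤ) + twoShift w) θ
    rw [show 2 * ((r + 1 : ℕ) : ℤ) + twoShift w - 1 = 2 * r + twoShift w + 1 by
      push_cast; ring] at h
    push_cast at h ⊢
    rw [show π * (2 / π) = 2 by field_simp]
    linarith

lemma sum_mufilt_mul (n m : ℕ) (hm : 0 < m) (hmn : m < n) (g : ℕ → ℝ) :
    ∑ j ∈ range (n + m), mufilt n m j * g j =
      1 / (2 * m) * ∑ r ∈ range (2 * m), ∑ j ∈ range (n - m + r + 1), g j := by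
  have hm' : (m : ℝ) ≠ 0 := by positivity
  have h1 : ∀ r ∈ range (2 * m), ∑ j ∈ range (n - m + r + 1), g j =
      ∑ j ∈ range (n + m), if j - (n - m) ≤ r then g j else 0 := by
    intro r hr
    rw [Finset.mem_range] at hr
    rw [← sum_filter]
    refine sum_congr ?_ fun _ _ => rfl
    ext j
    simp only [Finset.mem_range, Finset.mem_filter]
    omega
  rw [sum_congr rfl h1, sum_comm, mul_sum]
  refine sum_congr rfl fun j hj => ?_
  rw [Finset.mem_range] at hj
  rw [← sum_filter, sum_const, nsmul_eq_mul]
  have h2 : (range (2 * m)).filter (fun r => j - (n - m) ≤ r) = Finset.Ico (j - (n - m)) (2 * m) := by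
    ext r
    simp only [Finset.mem_range, Finset.mem_filter, Finset.mem_Ico]
    omega
  rw [h2, Nat.card_Ico, mufilt]
  split_ifs with h
  · rw [Nat.sub_eq_zero_of_le h, Nat.sub_zero]
    push_cast
    field_simp
  · rw [show 2 * m - (j - (n - m)) = n + m - j by omega, Nat.cast_sub (by omega)]
    push_cast
    field_simp

lemma sum_mufilt_mul_trigBasis (w : ChebKind) (n m : ℕ) (hm : 0 < m) (hmn : m < n) (s t : ℝ) :
    ∑ j ∈ range (n + m), mufilt n m j * (trigBasis w j s * trigBasis w j t) =
      1 / (4 * π * m) *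
        (dirKer (2 * n + twoShift w : ℕ) (t - s) * dirKer (2 * m : ℕ) (t - s) +
          reflSign w *
            (dirKer (2 * n + twoShift w : ℕ) (t + s) * dirKer (2 * m : ℕ) (t + s))) := by
  have hm' : (m : ℝ) ≠ 0 := by positivity
  have hπ := pi_pos.ne'
  have key : ∀ θ, ∑ j ∈ range (n + m), mufilt n m j *
      (π * trigNorm w j ^ 2 * cos ((2 * j + twoShift w) * θ / 2)) =
      1 / (2 * m) * (dirKer (2 * n + twoShift w : ℕ) θ * dirKer (2 * m : ℕ) θ) - kerOffset w := by
    intro θ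
    rw [sum_mufilt_mul n m hm hmn, ← dirKer_mul]
    simp_rw [sum_trigNorm_sq_mul_cos]
    rw [sum_sub_distrib, sum_const, card_range, nsmul_eq_mul, mul_sub]
    congr 1
    · congr 1
      refine sum_congr rfl fun r _ => ?_
      congr 1
      push_cast [Nat.cast_sub hmn.le]
      ring
    · push_cast; field_simp
  have hoff : kerOffset w * (1 + reflSign w) = 0 := by
    cases w <;> simp [kerOffset, reflSign]
  have hsplit : ∀ j, mufilt n m j * (trigBasis w j s * trigBasis w j t) =
      1 / (2 * π) * (mufilt n m j *
        (π * trigNorm w j ^ 2 * cos ((2 * j + twoShift w) * (t - s) / 2))) +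
      1 / (2 * π) * reflSign w * (mufilt n m j *
        (π * trigNorm w j ^ 2 * cos ((2 * j + twoShift w) * (t + s) / 2))) := by
    intro j
    rw [trigBasis_mul, ← mul_sub, ← mul_add]
    field_simp
  rw [sum_congr rfl fun j _ => hsplit j, sum_add_distrib, ← mul_sum, ← mul_sum, key, key]
  have e : (1 : ℝ) / (4 * π * m) = 1 / (2 * π) * (1 / (2 * m)) := by field_simp; norm_num
  rw [e]
  linear_combination (-1 / (2 * π)) * hoff

lemma sum_Icc_one (n : ℕ) (F : ℕ → ℝ) : ∑ k ∈ Finset.Icc 1 n, F k = ∑ l ∈ range n, F (l + 1) := by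
  rw [Finset.range_eq_Ico, Finset.sum_Ico_add' F 0 n 1]
  rfl

/-- Whether `0` belongs to the equispaced grid containing the symmetrised nodes. -/
def zeroCount : ChebKind → ℕ
  | .one => 0 | .two => 1 | .three => 0 | .four => 1

/-- Whether `π` belongs to the equispaced grid containing the symmetrised nodes. -/
def piCount : ChebKind → ℕ
  | .one => 0 | .two => 1 | .three => 1 | .four => 0

lemma tNode_eq (w : ChebKind) (n k : ℕ) (hn : 0 < n) :
    tNode w n k = (k - (1 - zeroCount w) / 2) * (2 * π / (2 * n + twoShift w : ℕ)) := by
  have hn' : (n : ℝ) ≠ 0 := by positivity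
  have h1 : (n : ℝ) + 1 ≠ 0 := by positivity
  have h2 : 2 * (n : ℝ) + 1 ≠ 0 := by positivity
  have h3 : 2 * (n : ℝ) + 2 ≠ 0 := by positivity
  cases w <;> simp only [tNode, zeroCount, twoShift] <;> push_cast
  · field_simp; ring
  · field_simp; ring
  · field_simp; ring
  · field_simp; ring

lemma tNode_mem (w : ChebKind) {n k : ℕ} (hk : k ∈ Finset.Icc 1 n) :
    0 < tNode w n k ∧ tNode w n k < π := by
  obtain ⟨h1, h2⟩ := Finset.mem_Icc.mp hk
  have h1' : (1 : ℝ) ≤ k := by exact_mod_cast h1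
  have h2' : (k : ℝ) ≤ n := by exact_mod_cast h2
  have hπ := pi_pos
  cases w <;> simp only [tNode] <;> refine ⟨?_, ?_⟩
  · have : (0 : ℝ) < 2 * k - 1 := by linarith
    have : (0 : ℝ) < n := by linarith
    positivity
  · rw [div_lt_iff₀ (by linarith)]; nlinarith
  · positivity
  · rw [div_lt_iff₀ (by linarith)]; nlinarith
  · have : (0 : ℝ) < 2 * k - 1 := by linarith
    positivity
  · rw [div_lt_iff₀ (by linarith)]; nlinarith
  · positivity
  · rw [div_lt_iff₀ (by linarith)]; nlinarith

lemma sum_symmetrized_nodes (w : ChebKind) (n : ℕ) (hn : 0 < n) (G : ℝ → ℝ) :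
    ∑ l ∈ range (2 * n + twoShift w),
        G (-tNode w n n + l * (2 * π / (2 * n + twoShift w : ℕ))) =
      ∑ k ∈ Finset.Icc 1 n, (G (tNode w n k) + G (-tNode w n k)) +
        zeroCount w * G 0 + piCount w * G π := by
  have hM : ((2 * n + twoShift w : ℕ) : ℝ) ≠ 0 := by positivity
  have hsplit : 2 * n + twoShift w = n + zeroCount w + n + piCount w := by
    cases w <;> simp only [twoShift, zeroCount, piCount] <;> ring
  simp_rw [tNode_eq w n _ hn]
  set b : ℝ := 2 * π / (2 * n + twoShift w : ℕ) with hb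
  have hbπ : ((2 * n + twoShift w : ℕ) : ℝ) * b = 2 * π := by rw [hb]; field_simp
  clear_value b
  rw [hsplit] at hbπ ⊢
  push_cast at hbπ
  rw [sum_range_add, sum_range_add, sum_range_add, sum_Icc_one, sum_add_distrib,
    ← sum_range_reflect]
  have e1 : ∀ l ∈ range n, G (-(((n : ℝ) - (1 - zeroCount w) / 2) * b) + ((n - 1 - l : ℕ) : ℝ) * b)
      = G (-((((l + 1 : ℕ) : ℝ) - (1 - zeroCount w) / 2) * b)) := by
    intro l hl
    rw [Finset.mem_range] at hl
    congr 1
    rw [show n - 1 - l = n - (l + 1) by omega, Nat.cast_sub (by omega)]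
    ring
  have e2 : ∀ l : ℕ, G (-(((n : ℝ) - (1 - zeroCount w) / 2) * b)
        + ((n + zeroCount w + l : ℕ) : ℝ) * b)
      = G ((((l + 1 : ℕ) : ℝ) - (1 - zeroCount w) / 2) * b) := by
    intro l
    congr 1
    push_cast
    ring
  have e3 : ∑ l ∈ range (zeroCount w), G (-(((n : ℝ) - (1 - zeroCount w) / 2) * b)
      + ((n + l : ℕ) : ℝ) * b) = zeroCount w * G 0 := by
    cases w <;> simp [zeroCount]
  have e4 : ∑ l ∈ range (piCount w), G (-(((n : ℝ) - (1 - zeroCount w) / 2) * b)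
      + ((n + zeroCount w + n + l : ℕ) : ℝ) * b) = piCount w * G π := by
    cases w <;> simp [zeroCount, piCount] at hbπ ⊢ <;> congr 1 <;> linarith
  rw [sum_congr rfl e1, sum_congr rfl fun l _ => e2 l, e3, e4]
  ring

lemma trigBasis_neg_mul (w : ChebKind) (i j : ℕ) (t : ℝ) :
    trigBasis w i (-t) * trigBasis w j (-t) = trigBasis w i t * trigBasis w j t := by
  cases w <;> simp [trigBasis, neg_div]

lemma zeroCount_mul_trigBasis (w : ChebKind) (j : ℕ) : zeroCount w * trigBasis w j 0 = 0 := by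
  cases w <;> simp [trigBasis, zeroCount]

lemma piCount_mul_trigBasis (w : ChebKind) (j : ℕ) : piCount w * trigBasis w j π = 0 := by
  cases w <;> simp only [trigBasis, piCount]
  · simp
  · rw [show ((j : ℝ) + 1) * π = ((j + 1 : ℕ) : ℝ) * π by push_cast; ring, sin_nat_mul_pi]
    simp
  · rw [show (2 * (j : ℝ) + 1) * (π / 2) = j * π + π / 2 by ring, cos_add_pi_div_two,
      sin_nat_mul_pi]
    simp
  · simp

lemma sum_trigBasis_mul_nodes (w : ChebKind) (n i j : ℕ) (hij : i + j < 2 * n) :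
    ∑ k ∈ Finset.Icc 1 n, trigBasis w i (tNode w n k) * trigBasis w j (tNode w n k) =
      if i = j then (2 * n + twoShift w : ℕ) / (2 * π) else 0 := by
  have hn : 0 < n := by omega
  have hπ := pi_pos.ne'
  have h := sum_symmetrized_nodes w n hn (fun t => trigBasis w i t * trigBasis w j t)
  simp only [trigBasis_neg_mul] at h
  rw [← mul_assoc, zeroCount_mul_trigBasis, ← mul_assoc, piCount_mul_trigBasis, zero_mul, add_zero,
    zero_mul, add_zero] at h
  simp_rw [← two_mul] at h
  rw [← mul_sum] at h
  set M := 2 * n + twoShift w with hM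
  have hc : ∀ t : ℝ, trigBasis w i t * trigBasis w j t = trigNorm w i * trigNorm w j / 2 *
      (cos (((j - i : ℤ) : ℝ) * t) + reflSign w * cos (((i + j + twoShift w : ℤ) : ℝ) * t)) := by
    intro t
    rw [trigBasis_mul]
    congr 3
    · push_cast; ring
    · congr 1; push_cast; ring
  simp_rw [hc] at h
  rw [← mul_sum, sum_add_distrib, ← mul_sum] at h
  simp_rw [hc]
  have hs : ∀ x : ℝ, 2 * x = trigNorm w i * trigNorm w j / 2 * (
      (if i = j then (M : ℝ) else 0) +
        reflSign w * (if i + j + twoShift w = 0 then (M : ℝ) else 0)) →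
      x = if i = j then (M : ℝ) / (2 * π) else 0 := by
    intro x hx
    by_cases hd : i = j
    · subst hd
      rw [if_pos rfl] at hx ⊢
      by_cases h0 : i + i + twoShift w = 0
      · obtain ⟨h1, h2⟩ := trigNorm_sq_of_eq_zero w (j := i) (by omega)
        rw [if_pos h0, ← sq, h1, h2] at hx
        field_simp at hx ⊢
        linarith
      · rw [if_neg h0, ← sq, trigNorm_sq_of_ne_zero w (by omega)] at hx
        field_simp at hx ⊢
        linarith
    · rw [if_neg hd, if_neg (by omega)] at hx
      rw [if_neg hd]
      linarith
  apply hs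
  rw [← h]
  congr 2
  · split_ifs with hd
    · simp [hd]
    · rw [sum_cos_equispaced_s18 M _ (by omega) (by rw [abs_lt]; omega)]
  · congr 1
    split_ifs with hd
    · have : ((i : ℤ) + j + twoShift w) = 0 := by exact_mod_cast hd
      simp [this]
    · rw [sum_cos_equispaced_s18 M _ (by omega) (by rw [abs_lt]; omega)]

lemma lam_eq (w : ChebKind) (n k : ℕ) (hn : 0 < n) :
    lam w n k = 2 * π / (2 * n + twoShift w : ℕ) * trigWeight w (tNode w n k) ^ 2 := by
  have hn' : (n : ℝ) ≠ 0 := by positivity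
  have h2 : √2 ^ 2 = (2 : ℝ) := Real.sq_sqrt (by norm_num)
  cases w <;> simp only [lam, trigWeight, twoShift, mul_pow, h2] <;> push_cast <;> field_simp <;>
    ring

lemma trigWeight_pos (w : ChebKind) {t : ℝ} (h0 : 0 < t) (h1 : t < π) : 0 < trigWeight w t := by
  have a1 := sin_pos_of_pos_of_lt_pi h0 h1
  have a2 : 0 < cos (t / 2) := cos_pos_of_mem_Ioo ⟨by linarith, by linarith⟩
  have a3 : 0 < sin (t / 2) := sin_pos_of_pos_of_lt_pi (by linarith) (by linarith)
  cases w <;> simp only [trigWeight] <;> positivity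

lemma degree_pPoly (w : ChebKind) (j : ℕ) : (pPoly w j).degree = j := by
  have hlt : (Chebyshev.U ℝ ((j : ℤ) - 1)).degree < (Chebyshev.U ℝ (j : ℤ)).degree := by
    rw [Chebyshev.degree_U_natCast]
    cases j with
    | zero => simp [Chebyshev.U_neg_one]
    | succ j =>
      rw [show ((j + 1 : ℕ) : ℤ) - 1 = j by push_cast; ring, Chebyshev.degree_U_natCast]
      exact_mod_cast Nat.lt_succ_self j
  have hc : √(2 / π) ≠ 0 := by positivity
  have hc' : 1 / √π ≠ 0 := by positivity
  cases w
  · cases j with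
    | zero => simp only [pPoly]; rw [degree_C hc']; rfl
    | succ j =>
      simp only [pPoly]
      rw [degree_C_mul hc, Chebyshev.degree_T]
      norm_cast
  · simp only [pPoly]
    rw [degree_C_mul hc, Chebyshev.degree_U_natCast]
  · simp only [pPoly]
    rw [degree_C_mul hc', degree_sub_eq_left_of_degree_lt hlt, Chebyshev.degree_U_natCast]
  · simp only [pPoly]
    rw [degree_C_mul hc', degree_add_eq_left_of_degree_lt hlt, Chebyshev.degree_U_natCast]

/-- The orthonormal polynomials as a sequence with `degree p_j = j`. -/
noncomputable def pSequence (w : ChebKind) : Polynomial.Sequence ℝ where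
  elems' := pPoly w
  degree_eq' := degree_pPoly w

lemma sum_lam_mul_pEval (w : ChebKind) (n i j : ℕ) (hij : i + j < 2 * n) :
    ∑ k ∈ Finset.Icc 1 n, lam w n k * pEval w i (xNode w n k) * pEval w j (xNode w n k) =
      if i = j then 1 else 0 := by
  have hn : 0 < n := by omega
  have hM : ((2 * n + twoShift w : ℕ) : ℝ) ≠ 0 := by positivity
  have hπ := pi_pos.ne'
  have h : ∀ k, lam w n k * pEval w i (xNode w n k) * pEval w j (xNode w n k) =
      2 * π / (2 * n + twoShift w : ℕ) *
        (trigBasis w i (tNode w n k) * trigBasis w j (tNode w n k)) := by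
    intro k
    rw [lam_eq w n k hn, ← pEval_mul_trigWeight, ← pEval_mul_trigWeight, xNode]
    ring
  simp_rw [h]
  rw [← mul_sum, sum_trigBasis_mul_nodes w n i j hij]
  split_ifs
  · field_simp
  · simp

lemma VP_pPoly (w : ChebKind) (n m i : ℕ) (hm : 0 < m) (hmn : m < n) (hi : i ≤ n - m) (x : ℝ) :
    VP w n m (fun y => (pPoly w i).eval y) x = (pPoly w i).eval x := by
  have h : VP w n m (fun y => (pPoly w i).eval y) x =
      ∑ j ∈ range (n + m), mufilt n m j * pEval w j x *
        ∑ k ∈ Finset.Icc 1 n, lam w n k * pEval w i (xNode w n k) * pEval w j (xNode w n k) := by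
    simp only [VP, Phi, mul_sum]
    rw [sum_comm]
    refine sum_congr rfl fun j _ => sum_congr rfl fun k _ => ?_
    simp only [pEval]
    ring
  rw [h, sum_congr rfl fun j hj => by
    rw [sum_lam_mul_pEval w n i j (by rw [Finset.mem_range] at hj; omega)]]
  simp only [mul_ite, mul_one, mul_zero]
  rw [sum_ite_eq, if_pos (by rw [Finset.mem_range]; omega), mufilt, if_pos hi, one_mul, pEval]

lemma VP_eval_polynomial (w : ChebKind) (n m : ℕ) (hm : 0 < m) (hmn : m < n) (P : ℝ[X])
    (hP : P.natDegree ≤ n - m) (x : ℝ) : VP w n m (fun y => P.eval y) x = P.eval x := by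
  have hmem : P ∈ Submodule.span ℝ (pSequence w '' Set.Iic (n - m)) := by
    rw [Polynomial.Sequence.span_degreeLE]
    · exact mem_degreeLE.mpr (natDegree_le_iff_degree_le.mp hP)
    · intro i _
      exact (leadingCoeff_ne_zero.mpr (Polynomial.Sequence.ne_zero _ i)).isUnit
  clear hP
  induction hmem using Submodule.span_induction with
  | mem p hp =>
    obtain ⟨i, hi, rfl⟩ := hp
    exact VP_pPoly w n m i hm hmn hi x
  | zero => simp [VP]
  | add p q _ _ hp hq =>
    simp only [VP, eval_add, add_mul, sum_add_distrib] at hp hq ⊢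
    rw [hp, hq]
  | smul a p _ hp =>
    simp only [VP, eval_smul, smul_eq_mul, mul_assoc, ← mul_sum] at hp ⊢
    rw [hp]

lemma abs_Phi_mul_trigWeight_le (w : ChebKind) (n m k : ℕ) (hm : 0 < m) (hmn : m < n)
    (hk : k ∈ Finset.Icc 1 n) (t : ℝ) :
    |Phi w n m k (cos t) * trigWeight w t| ≤ trigWeight w (tNode w n k) *
      (1 / (2 * m * (2 * n + twoShift w : ℕ)) *
        (|dirKer (2 * n + twoShift w : ℕ) (t + tNode w n k) *
            dirKer (2 * m : ℕ) (t + tNode w n k)| +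
          |dirKer (2 * n + twoShift w : ℕ) (t + -tNode w n k) *
            dirKer (2 * m : ℕ) (t + -tNode w n k)|)) := by
  have hn : 0 < n := by omega
  have hM : (0 : ℝ) < (2 * n + twoShift w : ℕ) := by positivity
  have hm' : (0 : ℝ) < m := by positivity
  have hπ := pi_pos
  have hu := trigWeight_pos w (tNode_mem w hk).1 (tNode_mem w hk).2
  have h : Phi w n m k (cos t) * trigWeight w t = 2 * π / (2 * n + twoShift w : ℕ) *
      trigWeight w (tNode w n k) *
        ∑ j ∈ range (n + m), mufilt n m j * (trigBasis w j (tNode w n k) * trigBasis w j t) := by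
    rw [Phi, lam_eq w n k hn, mul_sum, sum_mul, mul_sum]
    refine sum_congr rfl fun j _ => ?_
    rw [← pEval_mul_trigWeight, ← pEval_mul_trigWeight, xNode]
    ring
  have hσ : |reflSign w| = 1 := by cases w <;> simp [reflSign]
  rw [h, sum_mufilt_mul_trigBasis w n m hm hmn, abs_mul, abs_mul, abs_mul,
    abs_of_pos (by positivity : 0 < 2 * π / ((2 * n + twoShift w : ℕ) : ℝ)), abs_of_pos hu,
    abs_of_pos (by positivity : 0 < 1 / (4 * π * m)), ← sub_eq_add_neg]
  set M := 2 * n + twoShift w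
  have h3 := abs_add_le (dirKer M (t - tNode w n k) * dirKer (2 * m : ℕ) (t - tNode w n k))
    (reflSign w * (dirKer M (t + tNode w n k) * dirKer (2 * m : ℕ) (t + tNode w n k)))
  rw [abs_mul (reflSign w), hσ, one_mul, add_comm |_|] at h3
  refine (mul_le_mul_of_nonneg_left (mul_le_mul_of_nonneg_left h3 (by positivity))
    (by positivity)).trans (le_of_eq ?_)
  field_simp
  ring

/-- The weighted Lebesgue constant of VP interpolation is at most `sqrt (n_w / m)`. -/
lemma abs_VP_mul_trigWeight_le (w : ChebKind) (n m : ℕ) (hm : 0 < m) (hmn : m < n) (g : ℝ → ℝ)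
    (B : ℝ) (hB : 0 ≤ B)
    (hg : ∀ k ∈ Finset.Icc 1 n, |g (xNode w n k)| * trigWeight w (tNode w n k) ≤ B) (t : ℝ) :
    |VP w n m g (cos t) * trigWeight w t| ≤ √(nw w n / m) * B := by
  have hn : 0 < n := by omega
  set M := 2 * n + twoShift w with hMdef
  have hM : (0 : ℝ) < M := by positivity
  have hm' : (0 : ℝ) < m := by positivity
  set G : ℝ → ℝ := fun θ => |dirKer M (t + θ) * dirKer (2 * m : ℕ) (t + θ)| with hG
  have hnw : nw w n = M / 2 := by
    cases w <;> simp only [nw, hMdef, twoShift] <;> push_cast <;> ring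
  have hsum : ∑ k ∈ Finset.Icc 1 n, (G (tNode w n k) + G (-tNode w n k)) ≤
      M * √(M * (2 * m : ℕ)) := by
    have h1 := sum_symmetrized_nodes w n hn G
    have h2 := sum_abs_dirKer_mul_equispaced M (2 * m) (by omega) (t + -tNode w n n)
    have h3 : (0 : ℝ) ≤ zeroCount w * G 0 := by positivity
    have h4 : (0 : ℝ) ≤ piCount w * G π := by positivity
    simp only [add_assoc t] at h2
    linarith
  calc |VP w n m g (cos t) * trigWeight w t|
      = |∑ k ∈ Finset.Icc 1 n, g (xNode w n k) * (Phi w n m k (cos t) * trigWeight w t)| := by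
        rw [VP, sum_mul]; simp only [mul_assoc]
    _ ≤ ∑ k ∈ Finset.Icc 1 n, |g (xNode w n k)| * |Phi w n m k (cos t) * trigWeight w t| := by
        refine (Finset.abs_sum_le_sum_abs _ _).trans (le_of_eq ?_)
        simp only [abs_mul]
    _ ≤ ∑ k ∈ Finset.Icc 1 n, B * (1 / (2 * m * M) * (G (tNode w n k) + G (-tNode w n k))) := by
        refine sum_le_sum fun k hk => ?_
        refine (mul_le_mul_of_nonneg_left (abs_Phi_mul_trigWeight_le w n m k hm hmn hk t)
          (abs_nonneg _)).trans ?_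
        rw [← mul_assoc]
        exact mul_le_mul_of_nonneg_right (hg k hk) (by positivity)
    _ = B * (1 / (2 * m * M)) * ∑ k ∈ Finset.Icc 1 n, (G (tNode w n k) + G (-tNode w n k)) := by
        rw [mul_sum]; simp only [mul_assoc]
    _ ≤ B * (1 / (2 * m * M)) * (M * √(M * (2 * m : ℕ))) :=
        mul_le_mul_of_nonneg_left hsum (by positivity)
    _ = √(nw w n / m) * B := by
        have : (M : ℝ) * (2 * m : ℕ) = (2 * m) ^ 2 * (nw w n / m) := by
          rw [hnw]; push_cast; field_simp
        rw [this, Real.sqrt_mul (by positivity), Real.sqrt_sq (by positivity)]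
        field_simp

lemma exists_cos_eq {x : ℝ} (hx : x ∈ Set.Icc (-1 : ℝ) 1) : ∃ t, 0 ≤ t ∧ t ≤ π ∧ cos t = x :=
  ⟨arccos x, arccos_nonneg x, arccos_le_pi x, cos_arccos hx.1 hx.2⟩

lemma continuousOn_jac_uExp (w : ChebKind) :
    ContinuousOn (jac (uExp w).1 (uExp w).2) (Set.Icc (-1 : ℝ) 1) := by
  have h : 0 ≤ (uExp w).1 ∧ 0 ≤ (uExp w).2 := by cases w <;> norm_num [uExp]
  exact ((continuous_const.sub continuous_id).continuousOn.rpow_const fun _ _ => Or.inr h.1).mul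
    ((continuous_const.add continuous_id).continuousOn.rpow_const fun _ _ => Or.inr h.2)

lemma wnorm_nonneg (γ δ : ℝ) (f : ℝ → ℝ) : 0 ≤ wnorm γ δ f :=
  Real.sSup_nonneg (by rintro _ ⟨x, _, rfl⟩; exact abs_nonneg _)

lemma abs_mul_jac_le_wnorm {γ δ : ℝ} {f : ℝ → ℝ}
    (hf : ContinuousOn (fun x => f x * jac γ δ x) (Set.Icc (-1 : ℝ) 1)) {x : ℝ}
    (hx : x ∈ Set.Icc (-1 : ℝ) 1) : |f x * jac γ δ x| ≤ wnorm γ δ f :=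
  le_csSup (isCompact_Icc.image_of_continuousOn hf.abs).bddAbove ⟨x, hx, rfl⟩

lemma bestE_nonneg (γ δ : ℝ) (n : ℕ) (f : ℝ → ℝ) : 0 ≤ bestE γ δ n f :=
  Real.sInf_nonneg (by rintro _ ⟨P, _, rfl⟩; exact wnorm_nonneg _ _ _)

/-- VP interpolation is near-best in the weighted uniform norm. -/
lemma wnorm_VP_sub_le (w : ChebKind) (n m : ℕ) (hm : 0 < m) (hmn : m < n) (f : ℝ → ℝ)
    (hf : MemC0 (uExp w).1 (uExp w).2 f) :
    wnorm (uExp w).1 (uExp w).2 (fun x => VP w n m f x - f x) ≤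
      (1 + √(nw w n / m)) * bestE (uExp w).1 (uExp w).2 (n - m) f := by
  have hL : 0 < 1 + √(nw w n / m) := by positivity
  rw [mul_comm, ← div_le_iff₀ hL]
  refine le_csInf ⟨_, 0, by simp, rfl⟩ ?_
  rintro _ ⟨P, hP, rfl⟩
  rw [div_le_iff₀ hL]
  set B := wnorm (uExp w).1 (uExp w).2 (fun x => f x - P.eval x) with hBdef
  have hcont : ContinuousOn (fun x => (f x - P.eval x) * jac (uExp w).1 (uExp w).2 x)
      (Set.Icc (-1 : ℝ) 1) := by
    have := hf.2.1.sub (P.continuous.continuousOn.mul (continuousOn_jac_uExp w))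
    exact this.congr fun x _ => sub_mul _ _ _
  have hbound : ∀ t, 0 ≤ t → t ≤ π → |(f (cos t) - P.eval (cos t)) * trigWeight w t| ≤ B := by
    intro t h0 h1
    rw [← jac_cos w h0 h1]
    exact abs_mul_jac_le_wnorm (f := fun x => f x - P.eval x) hcont (cos_mem_Icc t)
  refine csSup_le ((Set.nonempty_Icc.mpr (by norm_num)).image _) ?_
  rintro _ ⟨x, hx, rfl⟩
  obtain ⟨t, h0, h1, rfl⟩ := exists_cos_eq hx
  have hVP := abs_VP_mul_trigWeight_le w n m hm hmn (fun x => f x - P.eval x) B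
    (wnorm_nonneg _ _ _) (fun k hk => by
      have hk' := tNode_mem w hk
      have := hbound _ hk'.1.le hk'.2.le
      rwa [abs_mul, abs_of_pos (trigWeight_pos w hk'.1 hk'.2)] at this) t
  have hsplit : VP w n m (fun x => f x - P.eval x) (cos t) =
      VP w n m f (cos t) - P.eval (cos t) := by
    rw [← VP_eval_polynomial w n m hm hmn P hP (cos t)]
    simp only [VP, sub_mul, sum_sub_distrib]
  simp only [jac_cos w h0 h1]
  have h := abs_sub (VP w n m (fun x => f x - P.eval x) (cos t) * trigWeight w t)
    ((f (cos t) - P.eval (cos t)) * trigWeight w t)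
  rw [← sub_mul, hsplit, sub_sub_sub_cancel_right, ← hsplit] at h
  linarith [hbound t h0 h1]

lemma bestE_le_Znorm_div {γ δ s : ℝ} (hs : 0 < s) {d : ℕ} (hd : 1 ≤ d) {f : ℝ → ℝ}
    (hf : BddAbove (zSet γ δ s f)) : bestE γ δ d f ≤ Znorm γ δ s f / (d : ℝ) ^ s := by
  have hd' : (0 : ℝ) < d := by exact_mod_cast hd
  rw [le_div_iff₀ (by positivity), mul_comm]
  have h1 : ((d : ℝ) + 1) ^ s * bestE γ δ d f ≤ sSup (zSet γ δ s f) := le_csSup hf ⟨d, hd, rfl⟩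
  have h2 : (d : ℝ) ^ s * bestE γ δ d f ≤ ((d : ℝ) + 1) ^ s * bestE γ δ d f :=
    mul_le_mul_of_nonneg_right (Real.rpow_le_rpow hd'.le (by linarith) hs.le) (bestE_nonneg _ _ _ _)
  rw [Znorm]
  linarith [wnorm_nonneg γ δ f]

/-- fully explicit VP error bound in terms of the degree parameters,
for `f ∈ Z_s(u)` with `u = sqrt(w·φ)`. -/
theorem stmt18 (w : ChebKind) (s : ℝ) (hs : 0 < s) (n m : ℕ) (hm : 0 < m) (hmn : m < n)
    (f : ℝ → ℝ) (hf : MemZ (uExp w).1 (uExp w).2 s f) :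
    wnorm (uExp w).1 (uExp w).2 (fun x => VP w n m f x - f x)
      ≤ (1 + Cw w * (Real.sqrt (nw w n / m) + 2 * π * mw w n m / Real.sqrt (m * nw w n))) *
          Znorm (uExp w).1 (uExp w).2 s f / ((n : ℝ) - m) ^ s := by
  have hn : 0 < n := by omega
  have hE := bestE_le_Znorm_div hs (d := n - m) (by omega) hf.2
  rw [Nat.cast_sub hmn.le] at hE
  have hC : 1 ≤ Cw w := by cases w <;> norm_num [Cw]
  have hmw : 0 ≤ mw w n m := by
    have : (1 : ℝ) ≤ n := by exact_mod_cast hn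
    cases w <;> simp only [mw] <;> first | positivity | linarith [(Nat.cast_nonneg m : (0 : ℝ) ≤ m)]
  have hX : √(nw w n / m) ≤
      Cw w * (√(nw w n / m) + 2 * π * mw w n m / √(m * nw w n)) := by
    have h1 : 0 ≤ 2 * π * mw w n m / √(m * nw w n) :=
      div_nonneg (mul_nonneg (by positivity) hmw) (Real.sqrt_nonneg _)
    have h2 := Real.sqrt_nonneg (nw w n / m)
    nlinarith
  have hE0 := bestE_nonneg (uExp w).1 (uExp w).2 (n - m) f
  rw [mul_div_assoc]
  exact (wnorm_VP_sub_le w n m hm hmn f hf.1).trans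
    (mul_le_mul (by linarith) hE hE0 (by linarith [Real.sqrt_nonneg (nw w n / m)]))
end
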